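/- Let Γ be a finitely generated group that is linear over some field. Then Γ satisfies a probabilistic identity if and only if Γ is virtually solvable. -/

import Mathlib

universe u v

/-- A group is linear (over some field) if it admits a faithful homomorphism into
`GL_k(F)` for some `k` and some field `F`. -/
def IsLinearGroup (Γ : Type u) [Group Γ] : Prop :=
  ∃ (F : Type v) (_ : Field F) (k : ℕ)
    (ρ : Γ →* Matrix.GeneralLinearGroup (Fin k) F), Function.Injective ρ

/-- A group is virtually solvable if it has a solvable subgroup of finite index. -/
def IsVirtuallySolvable (Γ : Type u) [Group Γ] : Prop :=
  ∃ H : Subgroup Γ, H.FiniteIndex ∧ IsSolvable H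

/-- The probability that a word `w ∈ F_n` evaluates to `1` at an independent uniformly
random `n`-tuple of elements of `Q`. -/
noncomputable def wordProb (Q : Type*) [Group Q] {n : ℕ} (w : FreeGroup (Fin n)) : ℝ :=
  (Nat.card {h : Fin n → Q // FreeGroup.lift h w = 1} : ℝ) / (Nat.card Q : ℝ) ^ n

/-- A nontrivial word `w ∈ F_n` is a probabilistic identity of `Γ` if there is `ε > 0`
such that in every finite quotient of `Γ` the probability that `w = 1` is at least `ε`. -/
def IsProbabilisticIdentity (Γ : Type u) [Group Γ] {n : ℕ} (w : FreeGroup (Fin n)) : Prop :=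
  w ≠ 1 ∧ ∃ ε : ℝ, 0 < ε ∧
    ∀ (N : Subgroup Γ) (_ : N.Normal), N.FiniteIndex → ε ≤ wordProb (Γ ⧸ N) w

section Piece1

/-- Burnside's theorem on irreducible matrix semigroups. -/
theorem burnside_span {K V H : Type*} [Field K] [IsAlgClosed K] [AddCommGroup V] [Module K V]
    [FiniteDimensional K V] [Nontrivial V] [Group H] (ρ : H →* Module.End K V)
    (hirr : ∀ W : Submodule K V, (∀ h, W ≤ W.comap (ρ h)) → W = ⊥ ∨ W = ⊤) :
    Submodule.span K (Set.range ρ) = ⊤ := by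
  classical
  let S : Subalgebra K (Module.End K V) := Algebra.adjoin K (Set.range ρ)
  have hS : Subalgebra.toSubmodule S = Submodule.span K (Set.range ρ) := by
    rw [Algebra.adjoin_eq_span]
    congr 1
    have : (MonoidHom.mrange ρ : Set (Module.End K V)) = Set.range ρ := MonoidHom.coe_mrange ρ
    rw [← this, Submonoid.closure_eq]
  have hmem : ∀ h, ρ h ∈ S := fun h => Algebra.subset_adjoin ⟨h, rfl⟩
  haveI : IsSimpleModule S V := by
    refine { eq_bot_or_eq_top := ?_, exists_pair_ne := ⟨⊥, ⊤, bot_ne_top⟩ }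
    intro W
    rcases hirr (W.restrictScalars K) (fun h x hx => W.smul_mem (⟨ρ h, hmem h⟩ : S) hx) with h | h
    · left
      simpa using h
    · right
      simpa using h
  rw [← hS, eq_top_iff]
  intro f _
  have hbij := IsSimpleModule.algebraMap_end_bijective_of_isAlgClosed (A := S) (V := V) K
  let f' : Module.End (Module.End S V) V :=
    { toFun := f
      map_add' := f.map_add
      map_smul' := by
        intro e x
        obtain ⟨c, rfl⟩ := hbij.2 e
        simp }
  obtain ⟨r, hr⟩ := jacobson_density (R := S) f'
    (Finset.univ.image (Module.finBasis K V))
  have : f = (r : Module.End K V) := by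
    refine (Module.finBasis K V).ext fun i => ?_
    exact hr _ (Finset.mem_image_of_mem _ (Finset.mem_univ i))
  rw [this]
  exact r.2

/-- Functions on `I → H` that are separately in an algebra of functions without zero divisors. -/
theorem sep_common_nonvanishing {K H I : Type*} [Field K] [Finite I] (A : Subalgebra K (H → K))
    (hA : ∀ f ∈ A, ∀ g ∈ A, f * g = 0 → f = 0 ∨ g = 0)
    [DecidableEq I] (F G : (I → H) → K)
    (hF : ∀ (x : I → H) (i : I), (fun h => F (Function.update x i h)) ∈ A)
    (hG : ∀ (x : I → H) (i : I), (fun h => G (Function.update x i h)) ∈ A)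
    (hF0 : ∃ x, F x ≠ 0) (hG0 : ∃ x, G x ≠ 0) : ∃ x, F x * G x ≠ 0 := by
  classical
  cases nonempty_fintype I
  have key : ∀ S : Finset I, ∃ x y : I → H, (∀ i ∈ S, x i = y i) ∧ F x ≠ 0 ∧ G y ≠ 0 := by
    intro S
    induction S using Finset.induction_on with
    | empty =>
      obtain ⟨x, hx⟩ := hF0
      obtain ⟨y, hy⟩ := hG0
      exact ⟨x, y, by simp, hx, hy⟩
    | insert i S hi ih =>
      obtain ⟨x, y, hxy, hx, hy⟩ := ih
      have : ∃ h, F (Function.update x i h) * G (Function.update y i h) ≠ 0 := by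
        by_contra hcon
        push Not at hcon
        rcases hA _ (hF x i) _ (hG y i) (funext hcon) with h | h
        · apply hx
          simpa using congrFun h (x i)
        · apply hy
          simpa using congrFun h (y i)
      obtain ⟨h, hh⟩ := this
      refine ⟨_, _, ?_, left_ne_zero_of_mul hh, right_ne_zero_of_mul hh⟩
      intro k hk
      by_cases hki : k = i
      · subst hki; simp
      · rw [Function.update_of_ne hki, Function.update_of_ne hki]
        exact hxy k ((Finset.mem_insert.1 hk).resolve_left hki)
  obtain ⟨x, y, hxy, hx, hy⟩ := key Finset.univ
  have : x = y := funext fun i => hxy i (Finset.mem_univ i)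
  subst this
  exact ⟨x, mul_ne_zero hx hy⟩

theorem sep_common_nonvanishing_finset {K H I J : Type*} [Field K] [Finite I]
    (A : Subalgebra K (H → K)) [Nonempty H]
    (hA : ∀ f ∈ A, ∀ g ∈ A, f * g = 0 → f = 0 ∨ g = 0)
    [DecidableEq I] (s : Finset J) (F : J → (I → H) → K)
    (hF : ∀ j ∈ s, ∀ (x : I → H) (i : I), (fun h => F j (Function.update x i h)) ∈ A)
    (hF0 : ∀ j ∈ s, ∃ x, F j x ≠ 0) : ∃ x, ∀ j ∈ s, F j x ≠ 0 := by
  classical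
  suffices h : ∃ x, ∏ j ∈ s, F j x ≠ 0 by
    obtain ⟨x, hx⟩ := h
    exact ⟨x, Finset.prod_ne_zero_iff.1 hx⟩
  induction s using Finset.induction_on with
  | empty => exact ⟨fun _ => Classical.arbitrary H, by simp⟩
  | insert j s hj ih =>
    simp_rw [Finset.prod_insert hj]
    have ih' := ih (fun k hk => hF k (Finset.mem_insert_of_mem hk))
      (fun k hk => hF0 k (Finset.mem_insert_of_mem hk))
    refine sep_common_nonvanishing A hA (F j) (fun x => ∏ k ∈ s, F k x)
      (hF j (Finset.mem_insert_self _ _)) ?_ (hF0 j (Finset.mem_insert_self _ _)) ih'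
    intro x i
    have : (fun h => ∏ k ∈ s, F k (Function.update x i h)) =
        ∏ k ∈ s, fun h => F k (Function.update x i h) := by
      ext h; simp
    rw [this]
    exact Subalgebra.prod_mem _ fun k hk => hF k (Finset.mem_insert_of_mem hk) x i

end Piece1

section Piece2

open Matrix IsLocalRing

section LeadTheory

variable {ι : Type*} [Fintype ι] [DecidableEq ι]

/-- `L` is a leading coefficient (reduction of a suitable rescaling) of the matrix `X`. -/
def Lead {E : Type*} [Field E] (O : ValuationSubring E)
    (X : Matrix ι ι E) (L : Matrix ι ι (ResidueField O)) : Prop :=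
  ∃ (c : E) (Y : Matrix ι ι O), c ≠ 0 ∧ X = c • Y.map (algebraMap O E) ∧
    Y.map (residue O) = L ∧ L ≠ 0

variable {E : Type*} [Field E] {O : ValuationSubring E}

theorem Lead.exists_of_ne_zero {X : Matrix ι ι E} (hX : X ≠ 0) : ∃ L, Lead O X L := by
  classical
  have hne : ∃ p : ι × ι, X p.1 p.2 ≠ 0 := by
    by_contra h
    push Not at h
    exact hX (by ext i j; exact h (i, j))
  obtain ⟨p0, hp0⟩ := hne
  obtain ⟨p, _, hp⟩ := Finset.exists_max_image (Finset.univ : Finset (ι × ι))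
    (fun p => O.valuation (X p.1 p.2)) ⟨p0, Finset.mem_univ _⟩
  have hc : X p.1 p.2 ≠ 0 := by
    intro h
    have := hp p0 (Finset.mem_univ _)
    rw [h, map_zero, le_zero_iff, map_eq_zero] at this
    exact hp0 this
  have hmem : ∀ i j, X i j / X p.1 p.2 ∈ O := by
    intro i j
    rw [← ValuationSubring.valuation_le_one_iff, map_div₀]
    exact div_le_one_of_le₀ (hp (i, j) (Finset.mem_univ _)) zero_le
  refine ⟨_, X p.1 p.2, Matrix.of fun i j => ⟨X i j / X p.1 p.2, hmem i j⟩, hc, ?_, rfl, ?_⟩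
  · ext i j
    simp only [Matrix.smul_apply, Matrix.map_apply, smul_eq_mul]
    change X i j = X p.1 p.2 * (X i j / X p.1 p.2)
    field_simp
  · intro h
    have h1 := congrFun (congrFun h p.1) p.2
    simp only [Matrix.map_apply, Matrix.zero_apply, Matrix.of_apply] at h1
    have : (⟨X p.1 p.2 / X p.1 p.2, hmem p.1 p.2⟩ : O) = 1 := by
      apply Subtype.ext
      exact div_self hc
    rw [this, map_one] at h1
    exact one_ne_zero h1

theorem Lead.ne_zero {X : Matrix ι ι E} {L : Matrix ι ι (ResidueField O)} (h : Lead O X L) :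
    L ≠ 0 := by
  obtain ⟨_, _, _, _, _, h⟩ := h
  exact h

theorem Lead.mul {X X' : Matrix ι ι E} {L L' : Matrix ι ι (ResidueField O)} (h : Lead O X L)
    (h' : Lead O X' L') (hne : L * L' ≠ 0) : Lead O (X * X') (L * L') := by
  obtain ⟨c, Y, hc, hX, hL, _⟩ := h
  obtain ⟨c', Y', hc', hX', hL', _⟩ := h'
  refine ⟨c * c', Y * Y', mul_ne_zero hc hc', ?_, ?_, hne⟩
  · rw [hX, hX', Matrix.map_mul, Matrix.smul_mul, Matrix.mul_smul, smul_smul]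
  · rw [Matrix.map_mul, hL, hL']

theorem Lead.isUnit_of_one {L : Matrix ι ι (ResidueField O)}
    (h : Lead O (1 : Matrix ι ι E) L) : IsUnit L := by
  classical
  obtain ⟨c, Y, hc, hX, hL, hne⟩ := h
  have hne' : Nonempty ι := by
    by_contra hem
    rw [not_nonempty_iff] at hem
    exact hne (Subsingleton.elim _ _)
  obtain ⟨i0⟩ := hne'
  have hY : ∀ i j, (Y i j : E) = if i = j then c⁻¹ else 0 := by
    intro i j
    have h1 := congrFun (congrFun hX i) j
    simp only [Matrix.smul_apply, Matrix.map_apply, smul_eq_mul, Matrix.one_apply] at h1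
    have h2 : (Y i j : E) = c⁻¹ * (if i = j then 1 else 0) := by
      rw [h1, ← mul_assoc, inv_mul_cancel₀ hc, one_mul]
      rfl
    rw [h2]
    split_ifs <;> simp
  set y : O := Y i0 i0 with hy
  have hYd : Y = y • (1 : Matrix ι ι O) := by
    ext i j
    rw [hY i j]
    simp only [Matrix.smul_apply, smul_eq_mul, Matrix.one_apply]
    split_ifs with hij
    · simp [hy, hY]
    · simp
  have hL' : L = residue O y • (1 : Matrix ι ι (ResidueField O)) := by
    rw [← hL, hYd]
    ext i j
    by_cases hij : i = j
    · subst hij; simp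
    · simp [hij]
  have hry : residue O y ≠ 0 := by
    intro h0
    rw [h0, zero_smul] at hL'
    exact hne hL'
  rw [hL']
  rw [← Algebra.algebraMap_eq_smul_one]
  exact (IsUnit.mk0 _ hry).map (algebraMap (ResidueField O) (Matrix ι ι (ResidueField O)))

theorem rank_cancel {k : Type*} [Field k] {A B C : Matrix ι ι k}
    (h : B.rank ≤ (A * B).rank) (h0 : A * (B * C) = 0) : B * C = 0 := by
  have hker : LinearMap.ker B.mulVecLin ≤ LinearMap.ker (A * B).mulVecLin := by
    intro v hv
    simp only [LinearMap.mem_ker, Matrix.mulVecLin_apply] at hv ⊢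
    rw [← Matrix.mulVec_mulVec, hv, Matrix.mulVec_zero]
  have hfr : Module.finrank k (LinearMap.ker (A * B).mulVecLin) ≤
      Module.finrank k (LinearMap.ker B.mulVecLin) := by
    have h1 := LinearMap.finrank_range_add_finrank_ker (A * B).mulVecLin
    have h2 := LinearMap.finrank_range_add_finrank_ker B.mulVecLin
    unfold Matrix.rank at h
    omega
  have heq := Submodule.eq_of_le_of_finrank_le hker hfr
  apply Matrix.ext_of_mulVec_single
  intro i
  rw [Matrix.zero_mulVec, ← Matrix.mulVec_mulVec]
  have : C *ᵥ Pi.single i 1 ∈ LinearMap.ker (A * B).mulVecLin := by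
    rw [LinearMap.mem_ker, Matrix.mulVecLin_apply, Matrix.mulVec_mulVec, Matrix.mul_assoc, h0,
      Matrix.zero_mulVec]
  rw [← heq] at this
  simpa using this

end LeadTheory

section Generic

variable {ι : Type*} [Fintype ι] [DecidableEq ι]

theorem exists_scalar_cond {K k H I : Type*} [Field K] [Field k] [Algebra K k] [DecidableEq I]
    (A : Subalgebra K (H → K))
    (M : (I → H) → Matrix ι ι K)
    (hM : ∀ (x : I → H) (i : I) (p q : ι), (fun h => M (Function.update x i h) p q) ∈ A)
    (hspan : Submodule.span K (Set.range M) = ⊤)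
    {L L' : Matrix ι ι k} (hL : L ≠ 0) (hL' : L' ≠ 0) :
    ∃ F : (I → H) → K, (∀ (x : I → H) (i : I), (fun h => F (Function.update x i h)) ∈ A) ∧
      (∃ x, F x ≠ 0) ∧ ∀ x, F x ≠ 0 → L * (M x).map (algebraMap K k) * L' ≠ 0 := by
  classical
  have hex : ∃ x, L * (M x).map (algebraMap K k) * L' ≠ 0 := by
    by_contra hcon
    push Not at hcon
    have hall : ∀ X : Matrix ι ι K, L * X.map (algebraMap K k) * L' = 0 := by
      intro X
      have hX : X ∈ Submodule.span K (Set.range M) := by rw [hspan]; trivial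
      induction hX using Submodule.span_induction with
      | mem X hX => obtain ⟨x, rfl⟩ := hX; exact hcon x
      | zero => simp
      | add X Y _ _ hX hY =>
        rw [Matrix.map_add _ (map_add _), Matrix.mul_add, Matrix.add_mul, hX, hY, add_zero]
      | smul c X _ hX =>
        have : (c • X).map (algebraMap K k) = algebraMap K k c • X.map (algebraMap K k) := by
          ext; simp
        rw [this, Matrix.mul_smul, Matrix.smul_mul, hX, smul_zero]
    apply hL
    ext p b
    by_contra hpb
    apply hL'
    ext c q
    have h1 := congrFun (congrFun (hall (Matrix.single b c 1)) p) q
    have h2 : (Matrix.single b c (1 : K)).map (algebraMap K k) = Matrix.single b c 1 := by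
      rw [Matrix.map_single]; simp
    rw [h2] at h1
    rw [Matrix.mul_apply] at h1
    simp only [Matrix.zero_apply] at h1 hpb ⊢
    rw [Finset.sum_eq_single c] at h1
    · rw [Matrix.mul_single_apply_same] at h1
      simp only [mul_one] at h1
      exact (mul_eq_zero.1 h1).resolve_left hpb
    · intro c' _ hc'
      rw [Matrix.mul_single_apply_of_ne _ _ _ _ _ hc', zero_mul]
    · simp
  obtain ⟨x0, hx0⟩ := hex
  have : ∃ p q, (L * (M x0).map (algebraMap K k) * L') p q ≠ 0 := by
    by_contra h
    push Not at h
    exact hx0 (by ext p q; exact h p q)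
  obtain ⟨p, q, hpq⟩ := this
  have : ∃ l : Module.Dual K k, l ((L * (M x0).map (algebraMap K k) * L') p q) ≠ 0 := by
    by_contra h
    push Not at h
    exact hpq ((Module.forall_dual_apply_eq_zero_iff K _).1 h)
  obtain ⟨l, hl⟩ := this
  have hform : ∀ x, l ((L * (M x).map (algebraMap K k) * L') p q) =
      ∑ c, ∑ b, l (L p b * L' c q) * M x b c := by
    intro x
    rw [Matrix.mul_apply, map_sum]
    refine Finset.sum_congr rfl fun c _ => ?_
    rw [Matrix.mul_apply, Finset.sum_mul, map_sum]
    refine Finset.sum_congr rfl fun b _ => ?_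
    have : L p b * algebraMap K k (M x b c) * L' c q = M x b c • (L p b * L' c q) := by
      rw [Algebra.smul_def]; ring
    rw [Matrix.map_apply, this, map_smul, smul_eq_mul, mul_comm]
  refine ⟨fun x => l ((L * (M x).map (algebraMap K k) * L') p q), ?_, ⟨x0, hl⟩, ?_⟩
  · intro x i
    have : (fun h => l ((L * (M (Function.update x i h)).map (algebraMap K k) * L') p q)) =
        ∑ c, ∑ b, l (L p b * L' c q) • (fun h => M (Function.update x i h) b c) := by
      ext h
      simp [hform]
    rw [this]
    exact Subalgebra.sum_mem _ fun c _ => Subalgebra.sum_mem _ fun b _ =>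
      Subalgebra.smul_mem _ (hM x i b c) _
  · intro x hx h0
    apply hx
    simp [h0]

/-- Simultaneous generic choice. -/
theorem exists_generic {K k H I J : Type*} [Field K] [Field k] [Algebra K k] [DecidableEq I]
    [Finite I] [Nonempty H] (A : Subalgebra K (H → K))
    (hA : ∀ f ∈ A, ∀ g ∈ A, f * g = 0 → f = 0 ∨ g = 0)
    (s : Finset J) (M : J → (I → H) → Matrix ι ι K)
    (hM : ∀ j ∈ s, ∀ (x : I → H) (i : I) (p q : ι),
      (fun h => M j (Function.update x i h) p q) ∈ A)
    (hspan : ∀ j ∈ s, Submodule.span K (Set.range (M j)) = ⊤)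
    (L L' : J → Matrix ι ι k) (hL : ∀ j ∈ s, L j ≠ 0) (hL' : ∀ j ∈ s, L' j ≠ 0) :
    ∃ x, ∀ j ∈ s, L j * (M j x).map (algebraMap K k) * L' j ≠ 0 := by
  classical
  have h : ∀ j : s, ∃ F : (I → H) → K,
      (∀ (x : I → H) (i : I), (fun h => F (Function.update x i h)) ∈ A) ∧
      (∃ x, F x ≠ 0) ∧ ∀ x, F x ≠ 0 → L j * (M j x).map (algebraMap K k) * L' j ≠ 0 :=
    fun j => exists_scalar_cond A (M j) (hM j j.2) (hspan j j.2) (hL j j.2) (hL' j j.2)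
  choose F h1 h2 h3 using h
  obtain ⟨x, hx⟩ := sep_common_nonvanishing_finset A hA Finset.univ F
    (fun j _ => h1 j) (fun j _ => h2 j)
  exact ⟨x, fun j hj => h3 ⟨j, hj⟩ x (hx ⟨j, hj⟩ (Finset.mem_univ _))⟩

end Generic

end Piece2

section Piece3

open Matrix IsLocalRing

set_option linter.unusedSectionVars false

section ThmA

theorem isUnit_of_rank {ι k : Type*} [Fintype ι] [DecidableEq ι] [Field k] (L : Matrix ι ι k)
    (h : L.rank = Fintype.card ι) : IsUnit L := by
  rw [← Matrix.mulVec_surjective_iff_isUnit]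
  have h1 : LinearMap.range L.mulVecLin = ⊤ := by
    apply Submodule.eq_top_of_finrank_eq
    rw [Module.finrank_fintype_fun_eq_card]
    exact h
  exact LinearMap.range_eq_top.1 h1

/-- The standing data for the ping-pong style argument. -/
structure PPData (K E H G T ι : Type*) [Field K] [Field E] [Algebra K E]
    (O : ValuationSubring E) [Algebra K (ResidueField O)] [Group H] [Group G] [Fintype ι]
    [DecidableEq ι] where
  hκ : ∀ a : K, ∃ b : O, (b : E) = algebraMap K E a ∧ residue O b = algebraMap K (ResidueField O) a
  R : G →* Matrix ι ι E
  cst : H →* G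
  rK : H →* Matrix ι ι K
  hcst : ∀ h, R (cst h) = (rK h).map (algebraMap K E)
  hspan : Submodule.span K (Set.range rK) = ⊤
  α : T → (G →* G)
  hα : ∀ t, Function.Surjective (α t)
  β : T → (H →* H)
  hβ : ∀ t, Function.Surjective (β t)
  hαβ : ∀ t h, α t (cst h) = cst (β t h)
  A : Subalgebra K (H → K)
  hA : ∀ f ∈ A, ∀ g ∈ A, f * g = 0 → f = 0 ∨ g = 0
  hAe : ∀ t p q, (fun h => rK (β t h) p q) ∈ A
  hAe' : ∀ t p q, (fun h => rK (β t h⁻¹) p q) ∈ A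

namespace PPData

variable {K E H G T ι : Type*} [Field K] [Field E] [Algebra K E]
    {O : ValuationSubring E} [Algebra K (ResidueField O)] [Group H] [Group G] [Fintype ι]
    [DecidableEq ι] [Nonempty ι] (D : PPData K E H G T ι O)

theorem isUnit_R (g : G) : IsUnit (D.R g) := (Group.isUnit g).map D.R

theorem isUnit_κ (h : H) : IsUnit ((D.rK h).map (algebraMap K (ResidueField O))) :=
  ((Group.isUnit h).map D.rK).map (RingHom.mapMatrix (algebraMap K (ResidueField O)))

theorem exists_lead (g : G) : ∃ L, Lead O (D.R g) L :=
  Lead.exists_of_ne_zero (D.isUnit_R g).ne_zero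

theorem lead_cst (h : H) :
    Lead O (D.R (D.cst h)) ((D.rK h).map (algebraMap K (ResidueField O))) := by
  choose b hb hb' using D.hκ
  refine ⟨1, (D.rK h).map b, one_ne_zero, ?_, ?_, (D.isUnit_κ h).ne_zero⟩
  · rw [D.hcst, one_smul]
    ext i j
    simp only [Matrix.map_apply]
    exact (hb _).symm
  · ext i j
    simp only [Matrix.map_apply, hb']

theorem lead_mul_cst {g : G} {L} (hL : Lead O (D.R g) L) (h : H) :
    Lead O (D.R (g * D.cst h)) (L * (D.rK h).map (algebraMap K (ResidueField O))) := by
  rw [map_mul]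
  refine hL.mul (D.lead_cst h) ?_
  intro h0
  exact hL.ne_zero ((D.isUnit_κ h).mul_left_eq_zero.1 h0)

theorem lead_cst_mul {g : G} {L} (hL : Lead O (D.R g) L) (h : H) :
    Lead O (D.R (D.cst h * g)) ((D.rK h).map (algebraMap K (ResidueField O)) * L) := by
  rw [map_mul]
  refine (D.lead_cst h).mul hL ?_
  intro h0
  exact hL.ne_zero ((D.isUnit_κ h).mul_right_eq_zero.1 h0)

theorem exists_min : ∃ r : ℕ, (∃ g L, Lead O (D.R g) L ∧ L.rank ≤ r) ∧
    ∀ g L, Lead O (D.R g) L → r ≤ L.rank := by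
  classical
  have hex : ∃ r : ℕ, ∃ g L, Lead O (D.R g) L ∧ L.rank ≤ r := by
    obtain ⟨L, hL⟩ := D.exists_lead 1
    exact ⟨L.rank, 1, L, hL, le_rfl⟩
  exact ⟨Nat.find hex, Nat.find_spec hex, fun g L hL => Nat.find_min' hex ⟨g, L, hL, le_rfl⟩⟩

theorem span_β (t : T) : Submodule.span K (Set.range fun h => D.rK (D.β t h)) = ⊤ := by
  rw [← D.hspan]
  congr 1
  exact (D.hβ t).range_comp D.rK

theorem exists_common (r : ℕ) (hr : ∃ g L, Lead O (D.R g) L ∧ L.rank ≤ r) (S : Finset T) :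
    ∃ Y : G, ∀ t ∈ S, ∃ L, Lead O (D.R (D.α t Y)) L ∧ L.rank ≤ r := by
  classical
  induction S using Finset.induction_on with
  | empty => exact ⟨1, by simp⟩
  | insert t S ht ih =>
    obtain ⟨Y, hY⟩ := ih
    obtain ⟨y0, L0, hL0, hr0⟩ := hr
    obtain ⟨y, rfl⟩ := D.hα t y0
    have h1 : ∀ t', ∃ L, Lead O (D.R (D.α t' Y)) L ∧ (t' ∈ S → L.rank ≤ r) := by
      intro t'
      by_cases h : t' ∈ S
      · obtain ⟨L, hL, hr⟩ := hY t' h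
        exact ⟨L, hL, fun _ => hr⟩
      · obtain ⟨L, hL⟩ := D.exists_lead (D.α t' Y)
        exact ⟨L, hL, fun h' => absurd h' h⟩
    have h2 : ∀ t', ∃ L, Lead O (D.R (D.α t' y)) L ∧ (t' = t → L.rank ≤ r) := by
      intro t'
      by_cases h : t' = t
      · subst h
        exact ⟨L0, hL0, fun _ => hr0⟩
      · obtain ⟨L, hL⟩ := D.exists_lead (D.α t' y)
        exact ⟨L, hL, fun h' => absurd h' h⟩
    choose L hL hLr using h1
    choose L' hL' hLr' using h2
    obtain ⟨x, hx⟩ := exists_generic (I := Unit) D.A D.hA (insert t S)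
      (fun t' x => D.rK (D.β t' (x ())))
      (by
        intro j _ x i p q
        have := D.hAe j p q
        convert this using 2
        simp)
      (by
        intro j _
        rw [← D.span_β j]
        congr 1
        ext X
        constructor
        · rintro ⟨x, rfl⟩; exact ⟨x (), rfl⟩
        · rintro ⟨h, rfl⟩; exact ⟨fun _ => h, rfl⟩)
      L L' (fun j _ => (hL j).ne_zero) (fun j _ => (hL' j).ne_zero)
    refine ⟨Y * D.cst (x ()) * y, fun t' ht' => ⟨L t' *
      (D.rK (D.β t' (x ()))).map (algebraMap K (ResidueField O)) * L' t', ?_, ?_⟩⟩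
    · rw [map_mul, map_mul, map_mul, D.hαβ]
      exact (D.lead_mul_cst (hL t') _).mul (hL' t') (hx t' ht')
    · rcases Finset.mem_insert.1 ht' with rfl | h
      · exact (Matrix.rank_mul_le_right _ _).trans (hLr' _ rfl)
      · rw [Matrix.mul_assoc]
        exact (Matrix.rank_mul_le_left _ _).trans (hLr _ h)

theorem exists_z (r : ℕ) (hr : ∃ g L, Lead O (D.R g) L ∧ L.rank ≤ r) (S : Finset T) :
    ∃ z : G, ∀ t ∈ S, ∀ e : Bool,
      ∃ L, Lead O (D.R (D.α t (cond e z z⁻¹))) L ∧ L.rank ≤ r := by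
  classical
  obtain ⟨Y, hY⟩ := D.exists_common r hr S
  choose! L hL hLr using hY
  have h2 : ∀ t', ∃ L, Lead O (D.R (D.α t' Y⁻¹)) L := fun t => D.exists_lead _
  choose L' hL' using h2
  obtain ⟨x, hx⟩ := exists_generic (I := Unit) D.A D.hA (S ×ˢ (Finset.univ : Finset Bool))
      (fun t' x => D.rK (D.β t'.1 (cond t'.2 (x ()) (x ())⁻¹)))
      (by
        rintro ⟨j, e⟩ _ x i p q
        cases e
        · have := D.hAe' j p q
          convert this using 2
          simp
        · have := D.hAe j p q
          convert this using 2
          simp)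
      (by
        rintro ⟨j, e⟩ _
        rw [← D.span_β j]
        congr 1
        ext X
        constructor
        · rintro ⟨x, rfl⟩; exact ⟨_, rfl⟩
        · rintro ⟨h, rfl⟩; exact ⟨fun _ => cond e h h⁻¹, by cases e <;> simp⟩)
      (fun t => L t.1) (fun t => L' t.1)
      (fun j hj => (hL j.1 (Finset.mem_product.1 hj).1).ne_zero) (fun j _ => (hL' j.1).ne_zero)
  refine ⟨Y * D.cst (x ()) * Y⁻¹, fun t ht e => ⟨L t *
    (D.rK (D.β t (cond e (x ()) (x ())⁻¹))).map (algebraMap K (ResidueField O)) * L' t, ?_, ?_⟩⟩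
  · have hz : cond e (Y * D.cst (x ()) * Y⁻¹) (Y * D.cst (x ()) * Y⁻¹)⁻¹ =
        Y * D.cst (cond e (x ()) (x ())⁻¹) * Y⁻¹ := by
      cases e
      · simp [mul_assoc]
      · simp
    rw [hz, map_mul, map_mul, map_mul, D.hαβ]
    exact (D.lead_mul_cst (hL t ht) _).mul (hL' t) (hx (t, e) (by simp [ht]))
  · rw [Matrix.mul_assoc]
    exact (Matrix.rank_mul_le_left _ _).trans (hLr _ ht)

/-- no nontrivial twisted word vanishes identically -/
theorem main (η : G) (L0 : Matrix ι ι (ResidueField O)) (hη : Lead O (D.R η) L0)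
    (hL0 : ¬ IsUnit L0) {I : Type*} [Finite I] (W : List (T × I × Bool)) (hW : W ≠ [])
    (hch : W.IsChain fun a b => a.2.1 = b.2.1 → a.2.2 = b.2.2) :
    ∃ x : I → G,
      (W.map fun a => D.α a.1 (cond a.2.2 (x a.2.1) (x a.2.1)⁻¹)).prod ≠ 1 := by
  classical
  obtain ⟨r, hr, hmin⟩ := D.exists_min
  have hrc : r < Fintype.card ι := by
    by_contra hcon
    push Not at hcon
    apply hL0
    have h1 : L0.rank = Fintype.card ι :=
      le_antisymm (Matrix.rank_le_card_width _) (hcon.trans (hmin _ _ hη))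
    exact isUnit_of_rank _ h1
  set S : Finset T := (W.map Prod.fst).toFinset with hS
  obtain ⟨z, hz⟩ := D.exists_z r hr S
  choose! Z hZ hZr using hz
  have : Nonempty (T × I × Bool) := by
    cases W with
    | nil => exact absurd rfl hW
    | cons a _ => exact ⟨a⟩
  obtain ⟨v, hv⟩ := exists_generic (I := I × Bool) D.A D.hA
    ((W.toFinset ×ˢ W.toFinset).filter fun j => j.1.2.1 = j.2.2.1 → j.1.2.2 = j.2.2.2)
    (fun j v => D.rK (D.β j.1.1 (v (j.1.2.1, !j.1.2.2))⁻¹) * D.rK (D.β j.2.1 (v (j.2.2.1, j.2.2.2))))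
    (by
      rintro ⟨⟨t, i, e⟩, ⟨t', i', e'⟩⟩ _ x l p q
      simp only [Matrix.mul_apply]
      have : (fun h => ∑ j, D.rK (D.β t (Function.update x l h (i, !e))⁻¹) p j *
          D.rK (D.β t' (Function.update x l h (i', e'))) j q) =
          ∑ j, (fun h => D.rK (D.β t (Function.update x l h (i, !e))⁻¹) p j) *
          (fun h => D.rK (D.β t' (Function.update x l h (i', e'))) j q) := by
        ext h; simp
      rw [this]
      refine Subalgebra.sum_mem _ fun j _ => Subalgebra.mul_mem _ ?_ ?_
      · by_cases h : (i, !e) = l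
        · subst h
          simpa using D.hAe' t p j
        · simp only [Function.update_of_ne h]
          exact D.A.algebraMap_mem _
      · by_cases h : (i', e') = l
        · subst h
          simpa using D.hAe t' j q
        · simp only [Function.update_of_ne h]
          exact D.A.algebraMap_mem _)
    (by
      rintro ⟨⟨t, i, e⟩, ⟨t', i', e'⟩⟩ hj
      simp only [Finset.mem_filter] at hj
      have hne : ((i, !e) : I × Bool) ≠ (i', e') := by
        intro h
        simp only [Prod.mk.injEq] at h
        have := hj.2 h.1
        simp [this] at h
      rw [eq_top_iff, ← D.span_β t']
      apply Submodule.span_mono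
      rintro _ ⟨h, rfl⟩
      refine ⟨Function.update (fun _ => 1) (i', e') h, ?_⟩
      simp [Function.update_of_ne hne])
    (fun j => Z j.1.1 j.1.2.2) (fun j => Z j.2.1 j.2.2.2)
    (by
      rintro ⟨⟨t, i, e⟩, ⟨t', i', e'⟩⟩ hj
      simp only [Finset.mem_filter, Finset.mem_product, List.mem_toFinset] at hj
      exact (hZ t (by simp only [hS, List.mem_toFinset, List.mem_map]; exact ⟨_, hj.1.1, rfl⟩) e).ne_zero)
    (by
      rintro ⟨⟨t, i, e⟩, ⟨t', i', e'⟩⟩ hj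
      simp only [Finset.mem_filter, Finset.mem_product, List.mem_toFinset] at hj
      exact (hZ t' (by simp only [hS, List.mem_toFinset, List.mem_map]; exact ⟨_, hj.1.2, rfl⟩) e').ne_zero)
  let κ : H → Matrix ι ι (ResidueField O) := fun h => (D.rK h).map (algebraMap K (ResidueField O))
  let x : I → G := fun i => D.cst (v (i, true)) * z * (D.cst (v (i, false)))⁻¹
  let N : T × I × Bool → Matrix ι ι (ResidueField O) := fun a =>
    κ (D.β a.1 (v (a.2.1, a.2.2))) * Z a.1 a.2.2 * κ (D.β a.1 (v (a.2.1, !a.2.2))⁻¹)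
  let X : T × I × Bool → G := fun a => D.α a.1 (cond a.2.2 (x a.2.1) (x a.2.1)⁻¹)
  have hXN : ∀ a ∈ W, Lead O (D.R (X a)) (N a) := by
    rintro ⟨t, i, e⟩ ha
    have hx : X (t, i, e) = D.cst (D.β t (v (i, e))) * D.α t (cond e z z⁻¹) *
        D.cst (D.β t (v (i, !e))⁻¹) := by
      simp only [X, x]
      rw [← D.hαβ, ← D.hαβ, ← map_mul, ← map_mul]
      congr 1
      cases e
      · simp [mul_assoc]
      · simp
    rw [hx]
    exact D.lead_mul_cst (D.lead_cst_mul (hZ t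
      (by simp only [hS, List.mem_toFinset, List.mem_map]; exact ⟨_, ha, rfl⟩) e) _) _
  have hNr : ∀ a ∈ W, (N a).rank ≤ r := by
    rintro ⟨t, i, e⟩ ha
    refine (Matrix.rank_mul_le_left _ _).trans ((Matrix.rank_mul_le_right _ _).trans (hZr t
      (by simp only [hS, List.mem_toFinset, List.mem_map]; exact ⟨_, ha, rfl⟩) e))
  have hNN : ∀ a ∈ W, ∀ b ∈ W, (a.2.1 = b.2.1 → a.2.2 = b.2.2) → N a * N b ≠ 0 := by
    rintro ⟨t, i, e⟩ ha ⟨t', i', e'⟩ hb hab h0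
    have h1 := hv ((t, i, e), (t', i', e')) (by
      simp only [Finset.mem_filter, Finset.mem_product, List.mem_toFinset]
      exact ⟨⟨ha, hb⟩, hab⟩)
    apply h1
    have h2 : N (t, i, e) * N (t', i', e') = κ (D.β t (v (i, e))) *
        ((Z t e * (κ (D.β t (v (i, !e))⁻¹) * κ (D.β t' (v (i', e')))) * Z t' e') *
          κ (D.β t' (v (i', !e'))⁻¹)) := by
      simp only [N, Matrix.mul_assoc]
    rw [h2, (D.isUnit_κ _).mul_right_eq_zero, (D.isUnit_κ _).mul_left_eq_zero] at h0
    rw [Matrix.map_mul]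
    exact h0
  have key : ∀ W' : List (T × I × Bool), ∀ a : T × I × Bool, (∀ b ∈ a :: W', b ∈ W) →
      (a :: W').IsChain (fun a b => a.2.1 = b.2.1 → a.2.2 = b.2.2) →
      ∃ M, Lead O (D.R ((a :: W').map X).prod) (N a * M) := by
    intro W'
    induction W' with
    | nil =>
      intro a ha _
      refine ⟨1, ?_⟩
      simpa using hXN a (ha a (by simp))
    | cons b W'' ih =>
      intro a ha hc
      rw [List.isChain_cons_cons] at hc
      obtain ⟨M, hM⟩ := ih b (fun c hc => ha c (List.mem_cons_of_mem _ hc)) hc.2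
      have haW := ha a (by simp)
      have hbW := ha b (by simp)
      refine ⟨N b * M, ?_⟩
      rw [List.map_cons, List.prod_cons, map_mul]
      refine (hXN a haW).mul hM ?_
      intro h0
      refine hM.ne_zero (rank_cancel (A := N a) ?_ h0)
      refine (hNr b hbW).trans (hmin (X a * X b) _ ?_)
      rw [map_mul]
      exact (hXN a haW).mul (hXN b hbW) (hNN a haW b hbW hc.1)
  refine ⟨x, fun hprod => ?_⟩
  cases W with
  | nil => exact hW rfl
  | cons a W' =>
    obtain ⟨M, hM⟩ := key W' a (fun b hb => hb) hch
    have h1 : ((a :: W').map X).prod = 1 := hprod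
    rw [h1, map_one] at hM
    have h2 := Matrix.rank_of_isUnit _ hM.isUnit_of_one
    have h3 := (Matrix.rank_mul_le_left (N a) M).trans (hNr a (by simp))
    omega

end PPData

end ThmA

end Piece3

section Piece4

open Matrix IsLocalRing

set_option linter.style.haveILetI false

section IrrScalar

theorem exists_valuation {K E : Type*} [Field K] [Field E] [Algebra K E] [IsAlgClosed K] {x : E}
    (hx : x ∉ (algebraMap K E).range) :
    ∃ O : ValuationSubring E, (∀ k, algebraMap K E k ∈ O) ∧ x ∉ O := by
  have hic : IsIntegrallyClosedIn (algebraMap K E).range E := by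
    rw [Subring.isIntegrallyClosedIn_iff]
    intro y hy
    letI : Algebra K (algebraMap K E).range := (algebraMap K E).rangeRestrict.toAlgebra
    have : IsScalarTower K (algebraMap K E).range E := .of_algebraMap_eq fun _ => rfl
    have : Algebra.IsIntegral K (algebraMap K E).range := ⟨by
      rintro ⟨_, k, rfl⟩
      exact isIntegral_algebraMap (R := K) (A := (algebraMap K E).range) (x := k)⟩
    have hy' : IsIntegral K y := isIntegral_trans y hy
    obtain ⟨k, hk⟩ := (IsAlgClosed.algebraMap_bijective_of_isIntegral (k := K)
      (K := integralClosure K E)).2 ⟨y, hy'⟩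
    exact ⟨k, congrArg Subtype.val hk⟩
  obtain ⟨O, hO, hfO⟩ := Subring.exists_le_valuationSubring_of_isIntegrallyClosedIn hx
  exact ⟨O, fun k => hO ⟨k, rfl⟩, hfO⟩

theorem lead_unit_entries {E ι : Type*} [Field E] [Fintype ι] [DecidableEq ι]
    {O : ValuationSubring E} {X X' : Matrix ι ι E} (hXX : X * X' = 1)
    {L : Matrix ι ι (ResidueField O)} (hL : Lead O X L) (hu : IsUnit L) (a b c d : ι) :
    X a b * X' c d ∈ O := by
  obtain ⟨c0, Y, hc0, hX, hYL, _⟩ := hL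
  have hYu : IsUnit Y := by
    rw [Matrix.isUnit_iff_isUnit_det]
    apply isUnit_of_map_unit (residue O)
    rw [RingHom.map_det]
    rw [← Matrix.isUnit_iff_isUnit_det]
    have : (residue O).mapMatrix Y = L := hYL
    rw [this]
    exact hu
  obtain ⟨Yu, rfl⟩ := hYu
  have h1 : X' = c0⁻¹ • (↑Yu⁻¹ : Matrix ι ι O).map (algebraMap O E) := by
    have h3 : X * (c0⁻¹ • (↑Yu⁻¹ : Matrix ι ι O).map (algebraMap O E)) = 1 := by
      rw [hX, Matrix.smul_mul, Matrix.mul_smul, smul_smul, mul_inv_cancel₀ hc0, one_smul,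
        ← Matrix.map_mul, Units.mul_inv, Matrix.map_one _ (map_zero _) (map_one _)]
    have h4 : X' * X = 1 := mul_eq_one_comm.1 hXX
    calc X' = X' * (X * (c0⁻¹ • (↑Yu⁻¹ : Matrix ι ι O).map (algebraMap O E))) := by
          rw [h3, mul_one]
      _ = _ := by rw [← mul_assoc, h4, one_mul]
  rw [h1, hX]
  have : (c0 • (Yu : Matrix ι ι O).map (algebraMap O E)) a b *
    (c0⁻¹ • (↑Yu⁻¹ : Matrix ι ι O).map (algebraMap O E)) c d =
    ((Yu : Matrix ι ι O) a b * (↑Yu⁻¹ : Matrix ι ι O) c d : O) := by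
    simp only [Matrix.smul_apply, Matrix.map_apply, smul_eq_mul]
    change c0 * ((Yu : Matrix ι ι O) a b : E) * (c0⁻¹ * ((↑Yu⁻¹ : Matrix ι ι O) c d : E)) =
      ((Yu : Matrix ι ι O) a b : E) * ((↑Yu⁻¹ : Matrix ι ι O) c d : E)
    field_simp
  rw [this]
  exact Subtype.prop _

variable {K H Γ ι : Type*} [Field K] [Group H] [Group Γ] [Fintype ι] [DecidableEq ι]

/-- The group of polynomial maps `H → H` relative to the function algebra `A`. -/
def polyMaps (β : Γ →* MulAut H) (A : Subalgebra K (H → K)) (r : H →* Matrix ι ι K) :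
    Subgroup (H → H) where
  carrier := {u | (∀ t p q, (fun x => r (β t (u x)) p q) ∈ A) ∧
    (∀ t p q, (fun x => r (β t (u x)⁻¹) p q) ∈ A)}
  one_mem' := by
    constructor <;> intro t p q <;> simp only [Pi.one_apply, map_one, inv_one] <;>
    exact A.algebraMap_mem _
  mul_mem' := by
    rintro u v ⟨hu, hu'⟩ ⟨hv, hv'⟩
    constructor
    · intro t p q
      have : (fun x => r (β t ((u * v) x)) p q) =
          ∑ j, (fun x => r (β t (u x)) p j) * (fun x => r (β t (v x)) j q) := by
        ext x
        simp [Matrix.mul_apply]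
      rw [this]
      exact Subalgebra.sum_mem _ fun j _ => Subalgebra.mul_mem _ (hu t p j) (hv t j q)
    · intro t p q
      have : (fun x => r (β t ((u * v) x)⁻¹) p q) =
          ∑ j, (fun x => r (β t (v x)⁻¹) p j) * (fun x => r (β t (u x)⁻¹) j q) := by
        ext x
        rw [Pi.mul_apply, _root_.mul_inv_rev, map_mul, map_mul]
        simp [Matrix.mul_apply]
      rw [this]
      exact Subalgebra.sum_mem _ fun j _ => Subalgebra.mul_mem _ (hv' t p j) (hu' t j q)
  inv_mem' := by
    rintro u ⟨hu, hu'⟩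
    refine ⟨hu', ?_⟩
    simpa using hu

/-- Twisting. -/
def polyTwist (β : Γ →* MulAut H) (A : Subalgebra K (H → K)) (r : H →* Matrix ι ι K) (t : Γ) :
    polyMaps β A r →* polyMaps β A r where
  toFun u := ⟨fun x => β t (u.1 x), by
    constructor
    · intro s p q
      have := u.2.1 (s * t) p q
      simpa using this
    · intro s p q
      have := u.2.2 (s * t) p q
      simpa using this⟩
  map_one' := by
    apply Subtype.ext
    ext x
    simp
  map_mul' u v := by
    apply Subtype.ext
    ext x
    simp

/-- Generic matrix. -/
def polyMat (β : Γ →* MulAut H) (A : Subalgebra K (H → K)) (r : H →* Matrix ι ι K) :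
    polyMaps β A r →* Matrix ι ι A where
  toFun u := Matrix.of fun p q => ⟨fun x => r (u.1 x) p q, by simpa using u.2.1 1 p q⟩
  map_one' := by
    ext p q x
    by_cases h : p = q
    · subst h; simp
    · simp [h]
  map_mul' u v := by
    ext p q x
    simp [Matrix.mul_apply]

theorem irr_scalar [IsAlgClosed K] [Nonempty ι] (β : Γ →* MulAut H) (A : Subalgebra K (H → K))
    (hA : ∀ f ∈ A, ∀ g ∈ A, f * g = 0 → f = 0 ∨ g = 0)
    (hinv : ∀ f ∈ A, (fun h => f h⁻¹) ∈ A)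
    (hβ : ∀ t, ∀ f ∈ A, (fun h => f (β t h)) ∈ A)
    {I : Type*} [Finite I] (W : List (Γ × I × Bool)) (hW : W ≠ [])
    (hch : W.IsChain fun a b => a.2.1 = b.2.1 → a.2.2 = b.2.2)
    (hid : ∀ x : I → H, (W.map fun a => β a.1 (cond a.2.2 (x a.2.1) (x a.2.1)⁻¹)).prod = 1)
    (r : H →* Matrix ι ι K) (hr : ∀ p q, (fun h => r h p q) ∈ A)
    (hspan : Submodule.span K (Set.range r) = ⊤) (h : H) : ∃ c : K, r h = c • 1 := by
  classical
  have : Nontrivial A := ⟨⟨0, 1, fun h => by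
    have := congrFun (congrArg Subtype.val h) 1
    simp at this⟩⟩
  have : NoZeroDivisors A := ⟨fun {a b} hab => by
    rcases hA a.1 a.2 b.1 b.2 (congrArg Subtype.val hab) with h | h
    · left; exact Subtype.ext h
    · right; exact Subtype.ext h⟩
  have : IsDomain A := NoZeroDivisors.to_isDomain _
  let E := FractionRing A
  let fE : ι → ι → ι → ι → E := fun a b c d => algebraMap A E
    (⟨fun h => r h a b, hr a b⟩ * ⟨fun h => r h⁻¹ c d, hinv _ (hr c d)⟩)
  by_cases hconst : ∀ a b c d, fE a b c d ∈ (algebraMap K E).range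
  · have hc : ∀ a b c d, r h a b * r h⁻¹ c d =
        (1 : Matrix ι ι K) a b * (1 : Matrix ι ι K) c d := by
      intro a b c d
      obtain ⟨k, hk⟩ := hconst a b c d
      rw [IsScalarTower.algebraMap_apply K A E] at hk
      have h1 := IsFractionRing.injective A E hk
      have h2 := congrArg Subtype.val h1
      have h3 := congrFun h2 h
      have h4 := congrFun h2 1
      simp only [MulMemClass.mk_mul_mk, Pi.mul_apply, inv_one, map_one] at h3 h4
      rw [← h3, ← h4]
      rfl
    obtain ⟨i0⟩ := ‹Nonempty ι›
    refine ⟨r h i0 i0, ?_⟩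
    ext a b
    have h1 : ∑ d, r h a b * r h⁻¹ i0 d * r h d i0 = r h a b := by
      simp_rw [mul_assoc]
      rw [← Finset.mul_sum, ← Matrix.mul_apply, ← map_mul]
      simp
    rw [← h1]
    simp_rw [hc, mul_assoc]
    rw [← Finset.mul_sum, ← Matrix.mul_apply]
    simp [mul_comm]
  · exfalso
    push Not at hconst
    obtain ⟨a, b, c, d, hf⟩ := hconst
    obtain ⟨O, hO, hfO⟩ := exists_valuation hf
    let κ0 : K →+* O := (algebraMap K E).codRestrict O.toSubring hO
    letI : Algebra K (ResidueField O) := ((residue O).comp κ0).toAlgebra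
    let D : PPData K E H (polyMaps β A r) Γ ι O :=
      { hκ := fun a => ⟨κ0 a, rfl, rfl⟩
        R := ((algebraMap A E).mapMatrix : Matrix ι ι A →+* Matrix ι ι E).toMonoidHom.comp
          (polyMat β A r)
        cst :=
          { toFun := fun h => ⟨fun _ => h, by
              constructor <;> intro t p q <;> exact A.algebraMap_mem _⟩
            map_one' := rfl
            map_mul' := fun _ _ => rfl }
        rK := r
        hcst := by
          intro h
          ext p q
          change algebraMap A E _ = _
          rw [Matrix.map_apply, IsScalarTower.algebraMap_apply K A E]
          rfl
        hspan := hspan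
        α := polyTwist β A r
        hα := by
          intro t u
          refine ⟨polyTwist β A r t⁻¹ u, ?_⟩
          apply Subtype.ext
          funext x
          change β t (β t⁻¹ (u.1 x)) = u.1 x
          rw [← MulAut.mul_apply, ← map_mul]
          simp
        β := fun t => (β t).toMonoidHom
        hβ := fun t => (β t).surjective
        hαβ := by
          intro t h
          rfl
        A := A
        hA := hA
        hAe := fun t p q => hβ t _ (hr p q)
        hAe' := fun t p q => hinv _ (hβ t _ (hr p q)) }
    let η : polyMaps β A r := ⟨fun h => h, fun t p q => hβ t _ (hr p q),
      fun t p q => hinv _ (hβ t _ (hr p q))⟩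
    obtain ⟨L, hL⟩ := D.exists_lead η
    have hLu : ¬ IsUnit L := by
      intro hu
      apply hfO
      have h2 : D.R η * D.R η⁻¹ = 1 := by rw [← map_mul, mul_inv_cancel, map_one]
      have h4 : fE a b c d = D.R η a b * D.R η⁻¹ c d := map_mul _ _ _
      rw [h4]
      exact lead_unit_entries h2 hL hu a b c d
    obtain ⟨x, hx⟩ := D.main η L hL hLu W hW hch
    apply hx
    apply Subtype.ext
    funext y
    have := hid (fun i => (x i).1 y)
    have h2 := map_list_prod ((Pi.evalMonoidHom (fun _ : H => H) y).comp (polyMaps β A r).subtype)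
      (W.map fun a => D.α a.1 (cond a.2.2 (x a.2.1) (x a.2.1)⁻¹))
    refine h2.trans ?_
    rw [List.map_map]
    refine Eq.trans ?_ this
    refine congrArg List.prod (List.map_congr_left fun a _ => ?_)
    obtain ⟨t, i, e⟩ := a
    cases e <;> rfl

end IrrScalar

end Piece4

section Piece5

section SolvInd

theorem derived_succ_of_commute {H M : Type*} [Group H] [Monoid M] (ρ : H →* M) (m : ℕ)
    (hc : ∀ g ∈ derivedSeries H m, ∀ h ∈ derivedSeries H m, ρ g * ρ h = ρ h * ρ g) :
    ∀ h ∈ derivedSeries H (m + 1), ρ h = 1 := by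
  intro h hh
  have : derivedSeries H (m + 1) ≤ ρ.ker := by
    rw [derivedSeries_succ, Subgroup.commutator_le]
    intro a ha b hb
    rw [MonoidHom.mem_ker, commutatorElement_def, map_mul, map_mul, map_mul, hc a ha b hb,
      ← map_mul, ← map_mul, ← map_mul]
    simp
  exact this hh

theorem solv_ind {K H Γ : Type*} [Field K] [Group H] [Group Γ] [IsAlgClosed K]
    (β : Γ →* MulAut H) (A : Subalgebra K (H → K))
    (hA : ∀ f ∈ A, ∀ g ∈ A, f * g = 0 → f = 0 ∨ g = 0)
    (hinv : ∀ f ∈ A, (fun h => f h⁻¹) ∈ A)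
    (hβ : ∀ t, ∀ f ∈ A, (fun h => f (β t h)) ∈ A)
    {I : Type*} [Finite I] (W : List (Γ × I × Bool)) (hW : W ≠ [])
    (hch : W.IsChain fun a b => a.2.1 = b.2.1 → a.2.2 = b.2.2)
    (hid : ∀ x : I → H, (W.map fun a => β a.1 (cond a.2.2 (x a.2.1) (x a.2.1)⁻¹)).prod = 1)
    (n : ℕ) : ∀ (V : Type*) [AddCommGroup V] [Module K V] [FiniteDimensional K V],
      Module.finrank K V = n → ∀ ρ : H →* Module.End K V,
      (∀ (v : V) (f : Module.Dual K V), (fun h => f (ρ h v)) ∈ A) →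
      ∃ m, ∀ h ∈ derivedSeries H m, ρ h = 1 := by
  induction n using Nat.strong_induction_on with
  | _ n ih =>
  intro V _ _ _ hn ρ hρ
  rcases subsingleton_or_nontrivial V with hV | hV
  · exact ⟨0, fun h _ => Subsingleton.elim _ _⟩
  by_cases hirr : ∀ W : Submodule K V, (∀ h, W ≤ W.comap (ρ h)) → W = ⊥ ∨ W = ⊤
  · have hsp := burnside_span ρ hirr
    classical
    let b := Module.finBasis K V
    have : Nonempty (Fin (Module.finrank K V)) := ⟨⟨0, Module.finrank_pos⟩⟩
    let e := LinearMap.toMatrixAlgEquiv b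
    let r : H →* Matrix (Fin (Module.finrank K V)) (Fin (Module.finrank K V)) K :=
      (e : Module.End K V →* Matrix (Fin (Module.finrank K V)) (Fin (Module.finrank K V)) K).comp ρ
    have hr : ∀ p q, (fun h => r h p q) ∈ A := by
      intro p q
      have := hρ (b q) (b.coord p)
      convert this using 2
      exact LinearMap.toMatrixAlgEquiv_apply b _ _ _
    have hspan : Submodule.span K (Set.range r) = ⊤ := by
      have h1 : Set.range r = e.toLinearMap '' Set.range ρ := by
        rw [← Set.range_comp]; rfl
      rw [h1, Submodule.span_image, hsp, Submodule.map_top, LinearMap.range_eq_top]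
      exact e.surjective
    have hsc : ∀ h, ∃ c : K, ρ h = c • 1 := by
      intro h
      obtain ⟨c, hc⟩ := irr_scalar β A hA hinv hβ W hW hch hid r hr hspan h
      refine ⟨c, e.injective ?_⟩
      rw [map_smul, map_one]
      exact hc
    refine ⟨1, derived_succ_of_commute ρ 0 ?_⟩
    intro g _ h _
    obtain ⟨c, hc⟩ := hsc g
    rw [hc, smul_mul_assoc, one_mul, mul_smul_comm, mul_one]
  · push Not at hirr
    obtain ⟨U, hU, hbot, htop⟩ := hirr
    let ρ1 : H →* Module.End K U :=
      { toFun := fun h => (ρ h).restrict (hU h)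
        map_one' := by ext v; simp
        map_mul' := fun g h => by ext v; simp }
    let ρ2 : H →* Module.End K (V ⧸ U) :=
      { toFun := fun h => U.mapQ U (ρ h) (hU h)
        map_one' := by ext v; simp
        map_mul' := fun g h => by ext v; simp }
    obtain ⟨m1, hm1⟩ := ih (Module.finrank K U) (hn ▸ Submodule.finrank_lt htop) U rfl ρ1 (by
      intro v f
      obtain ⟨g, hg⟩ := LinearMap.exists_extend f
      have := hρ v g
      convert this using 2 with h
      rw [← hg]
      rfl)
    obtain ⟨m2, hm2⟩ := ih (Module.finrank K (V ⧸ U)) (by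
      have h1 := Submodule.finrank_quotient_add_finrank U
      have h2 : 0 < Module.finrank K U := Module.finrank_pos_iff.2
        ((Submodule.nontrivial_iff_ne_bot).2 hbot)
      omega) (V ⧸ U) rfl ρ2 (by
      intro v f
      obtain ⟨v, rfl⟩ := U.mkQ_surjective v
      exact hρ v (f.comp U.mkQ))
    have k1 : ∀ h ∈ derivedSeries H (max m1 m2), ∀ u ∈ U, ρ h u = u := by
      intro h hh u hu
      have := hm1 h (derivedSeries_antitone H (le_max_left _ _) hh)
      exact congrArg Subtype.val (LinearMap.congr_fun this ⟨u, hu⟩)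
    have k2 : ∀ h ∈ derivedSeries H (max m1 m2), ∀ v, ρ h v - v ∈ U := by
      intro h hh v
      have := hm2 h (derivedSeries_antitone H (le_max_right _ _) hh)
      have h2 := LinearMap.congr_fun this (U.mkQ v)
      exact (Submodule.Quotient.eq U).1 h2
    refine ⟨_, derived_succ_of_commute ρ (max m1 m2) ?_⟩
    intro g hg h hh
    ext v
    have key : ∀ g ∈ derivedSeries H (max m1 m2), ∀ h ∈ derivedSeries H (max m1 m2),
        ρ g (ρ h v) = ρ g v + (ρ h v - v) := by
      intro g hg h hh
      have h1 := k1 g hg _ (k2 h hh v)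
      rw [map_sub] at h1
      rw [← h1]
      abel
    change ρ g (ρ h v) = ρ h (ρ g v)
    rw [key g hg h hh, key h hh g hg]
    abel

end SolvInd

end Piece5

section Piece6

set_option linter.style.haveILetI false

section CoeffAlg

/-- Algebra generated by the matrix coefficients of finitely many representations
and their inverses. -/
def coeffAlg {R G S ι : Type*} [CommRing R] [Group G] [Fintype ι] [DecidableEq ι]
    (ρ : S → G →* Matrix ι ι R) : Subalgebra R (G → R) :=
  Algebra.adjoin R (Set.range (fun (x : Bool × S × ι × ι) (g : G) =>
    ρ x.2.1 (cond x.1 g g⁻¹) x.2.2.1 x.2.2.2))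

/-- Precomposition. -/
def precompAlg (R : Type*) {G G' : Type*} [CommRing R] (s : G' → G) : (G → R) →ₐ[R] (G' → R) :=
  AlgHom.pi (fun g => Pi.evalAlgHom R (fun _ : G => R) (s g))

variable {R G S ι : Type*} [CommRing R] [Group G] [Fintype ι] [DecidableEq ι]
    (ρ : S → G →* Matrix ι ι R)

theorem coeffAlg_mem (s : S) (p q : ι) : (fun g => ρ s g p q) ∈ coeffAlg ρ :=
  Algebra.subset_adjoin ⟨(true, s, p, q), rfl⟩

theorem coeffAlg_mem_inv (s : S) (p q : ι) : (fun g => ρ s g⁻¹ p q) ∈ coeffAlg ρ :=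
  Algebra.subset_adjoin ⟨(false, s, p, q), rfl⟩

theorem coeffAlg_noeth [Finite S] [IsNoetherianRing R] : IsNoetherianRing (coeffAlg ρ) := by
  classical
  have hfin : (Set.range (fun (x : Bool × S × ι × ι) (g : G) =>
    ρ x.2.1 (cond x.1 g g⁻¹) x.2.2.1 x.2.2.2)).Finite := Set.finite_range _
  have : Algebra.FiniteType R (coeffAlg ρ) := by
    rw [← Subalgebra.fg_iff_finiteType]
    exact ⟨hfin.toFinset, by rw [Set.Finite.coe_toFinset]; rfl⟩
  exact Algebra.FiniteType.isNoetherianRing R _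

theorem coeffAlg_precomp (t : G → G)
    (h : ∀ (e : Bool) s p q, (fun g => ρ s (cond e (t g) (t g)⁻¹) p q) ∈ coeffAlg ρ) :
    ∀ f ∈ coeffAlg ρ, (fun g => f (t g)) ∈ coeffAlg ρ := by
  have : coeffAlg ρ ≤ (coeffAlg ρ).comap (precompAlg R t) := by
    refine Algebra.adjoin_le ?_
    rintro _ ⟨⟨e, s, p, q⟩, rfl⟩
    exact h e s p q
  exact fun f hf => this hf

theorem coeffAlg_inv : ∀ f ∈ coeffAlg ρ, (fun g => f g⁻¹) ∈ coeffAlg ρ := by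
  apply coeffAlg_precomp
  intro e s p q
  cases e
  · simpa using coeffAlg_mem ρ s p q
  · exact coeffAlg_mem_inv ρ s p q

theorem coeffAlg_left (a : G) : ∀ f ∈ coeffAlg ρ, (fun g => f (a * g)) ∈ coeffAlg ρ := by
  apply coeffAlg_precomp
  intro e s p q
  cases e
  · have : (fun g => ρ s (a * g)⁻¹ p q) =
        ∑ j, ρ s a⁻¹ j q • (fun g => ρ s g⁻¹ p j) := by
      ext g
      simp [Matrix.mul_apply, mul_comm]
    simp only [cond_false]
    rw [this]
    exact Subalgebra.sum_mem _ fun j _ => Subalgebra.smul_mem _ (coeffAlg_mem_inv ρ s p j) _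
  · have : (fun g => ρ s (a * g) p q) =
        ∑ j, ρ s a p j • (fun g => ρ s g j q) := by
      ext g
      simp [Matrix.mul_apply]
    simp only [cond_true]
    rw [this]
    exact Subalgebra.sum_mem _ fun j _ => Subalgebra.smul_mem _ (coeffAlg_mem ρ s j q) _

theorem coeffAlg_right (a : G) : ∀ f ∈ coeffAlg ρ, (fun g => f (g * a)) ∈ coeffAlg ρ := by
  intro f hf
  have := coeffAlg_inv ρ _ (coeffAlg_left ρ a⁻¹ _ (coeffAlg_inv ρ f hf))
  simpa using this

end CoeffAlg

section Transl

variable {R G : Type*} [CommRing R] [Group G]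

/-- Left translation on a translation invariant algebra of functions. -/
def transl (A : Subalgebra R (G → R)) (hA : ∀ a : G, ∀ f ∈ A, (fun g => f (a * g)) ∈ A) (a : G) :
    A →+* A where
  toFun f := ⟨fun g => f.1 (a * g), hA a f.1 f.2⟩
  map_one' := rfl
  map_mul' _ _ := rfl
  map_zero' := rfl
  map_add' _ _ := rfl

/-- Action on ideals. -/
@[reducible] def translAction (A : Subalgebra R (G → R))
    (hA : ∀ a : G, ∀ f ∈ A, (fun g => f (a * g)) ∈ A) : MulAction G (Ideal A) where
  smul a M := M.comap (transl A hA a)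
  one_smul M := by
    change M.comap (transl A hA 1) = M
    ext f
    rw [Ideal.mem_comap]
    have : transl A hA 1 f = f := by
      apply Subtype.ext
      funext g
      change f.1 (1 * g) = f.1 g
      rw [one_mul]
    rw [this]
  mul_smul a b M := by
    change M.comap (transl A hA (a * b)) = (M.comap (transl A hA b)).comap (transl A hA a)
    ext f
    rw [Ideal.mem_comap, Ideal.mem_comap, Ideal.mem_comap]
    have : transl A hA (a * b) f = transl A hA b (transl A hA a f) := by
      apply Subtype.ext
      funext g
      change f.1 (a * b * g) = f.1 (a * (b * g))
      rw [mul_assoc]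
    rw [this]

/-- Vanishing ideal -/
def vanIdeal (A : Subalgebra R (G → R)) (D : Subgroup G) : Ideal A where
  carrier := {f | ∀ d ∈ D, f.1 d = 0}
  zero_mem' _ _ := rfl
  add_mem' := by
    intro f g hf hg d hd
    change f.1 d + g.1 d = 0
    rw [hf d hd, hg d hd, add_zero]
  smul_mem' := by
    intro c f hf d hd
    change c.1 d * f.1 d = 0
    rw [hf d hd, mul_zero]

theorem exists_connected [IsDomain R] (A : Subalgebra R (G → R))
    (hA : ∀ a : G, ∀ f ∈ A, (fun g => f (a * g)) ∈ A) [IsNoetherianRing A] :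
    ∃ D : Subgroup G, D.FiniteIndex ∧ ∀ D' : Subgroup G, D' ≤ D → D'.FiniteIndex →
      ∀ f ∈ A, ∀ g ∈ A, (∀ d ∈ D', f d * g d = 0) → (∀ d ∈ D', f d = 0) ∨ (∀ d ∈ D', g d = 0) := by
  letI := translAction A hA
  obtain ⟨_, ⟨D, hD, rfl⟩, hmax⟩ := WellFounded.has_min
    (wellFounded_gt (α := Ideal A))
    {J | ∃ D : Subgroup G, D.FiniteIndex ∧ vanIdeal A D = J} ⟨_, ⊤, inferInstance, rfl⟩
  have hmax' : ∀ D' : Subgroup G, D' ≤ D → D'.FiniteIndex → vanIdeal A D' = vanIdeal A D := by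
    intro D' hle hfi
    have h1 : vanIdeal A D ≤ vanIdeal A D' := fun f hf d hd => hf d (hle hd)
    have h2 := hmax _ ⟨D', hfi, rfl⟩
    by_contra hne
    exact h2 (lt_of_le_of_ne h1 (Ne.symm hne))
  have hprime : (vanIdeal A D).IsPrime := by
    let ev : A →+* R := (Pi.evalRingHom (fun _ : G => R) 1).comp A.subtype
    have hev : (RingHom.ker ev).IsPrime := RingHom.ker_isPrime ev
    have hle : vanIdeal A D ≤ RingHom.ker ev := fun f hf => hf 1 D.one_mem
    obtain ⟨P, hP, hPle⟩ := Ideal.exists_minimalPrimes_le hle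
    have hPp : P.IsPrime := hP.1.1
    have horb : ∀ d ∈ D, d • P ∈ (vanIdeal A D).minimalPrimes := by
      have hst : ∀ d ∈ D, ∀ Q : Ideal A, vanIdeal A D ≤ Q → vanIdeal A D ≤ d • Q := by
        intro d hd Q hQ f hf
        exact hQ (fun x hx => hf (d * x) (D.mul_mem hd hx))
      have hpr : ∀ d : G, ∀ Q : Ideal A, Q.IsPrime → (d • Q).IsPrime := by
        intro d Q hQ
        exact Ideal.comap_isPrime _ _
      have hmono : ∀ d : G, ∀ Q Q' : Ideal A, Q ≤ Q' → d • Q ≤ d • Q' := by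
        intro d Q Q' h
        exact Ideal.comap_mono h
      intro d hd
      refine ⟨⟨hpr d P hPp, hst d hd P hP.1.2⟩, ?_⟩
      intro Q ⟨hQ1, hQ2⟩ hQ
      have h1 := hmono d⁻¹ _ _ hQ
      rw [inv_smul_smul] at h1
      have h2 := hP.2 ⟨hpr d⁻¹ Q hQ1, hst d⁻¹ (D.inv_mem hd) Q hQ2⟩ h1
      have h3 := hmono d _ _ h2
      rwa [smul_inv_smul] at h3
    have hfin : (MulAction.orbit D P).Finite := by
      refine (Ideal.finite_minimalPrimes_of_isNoetherianRing A (vanIdeal A D)).subset ?_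
      rintro _ ⟨d, rfl⟩
      exact horb d d.2
    let St := MulAction.stabilizer D P
    have hSt : St.index ≠ 0 := by
      rw [MulAction.index_stabilizer]
      exact ((Set.ncard_pos hfin).2 ⟨P, MulAction.mem_orbit_self P⟩).ne'
    let D' := St.map D.subtype
    have hD'fi : D'.FiniteIndex := ⟨by
      rw [Subgroup.index_map_subtype]
      exact mul_ne_zero hSt hD.index_ne_zero⟩
    have hD'le : D' ≤ D := Subgroup.map_subtype_le _
    have hPle' : P ≤ vanIdeal A D' := by
      rintro f hf _ ⟨d, hd, rfl⟩
      have h1 : (d : G) • P = P := hd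
      rw [← h1] at hf
      have h2 := hPle hf
      change f.1 (d * 1) = 0 at h2
      simpa using h2
    rw [hmax' D' hD'le hD'fi] at hPle'
    rw [le_antisymm hP.1.2 hPle']
    exact hPp
  refine ⟨D, hD, fun D' hle hfi f hf g hg hfg => ?_⟩
  have heq := hmax' D' hle hfi
  have h1 : (⟨f, hf⟩ * ⟨g, hg⟩ : A) ∈ vanIdeal A D := by
    rw [← heq]
    exact hfg
  rcases hprime.mem_or_mem h1 with h | h
  · left
    rw [← heq] at h
    exact h
  · right
    rw [← heq] at h
    exact h

end Transl

end Piece6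

section Piece7

section Twisted

variable {Γ I : Type*} [Group Γ]

/-- The twisted word. -/
def tw (x : I → Γ) : Γ → List (I × Bool) → List (Γ × I × Bool)
  | _, [] => []
  | γ, (i, true) :: L => (γ, i, true) :: tw x (γ * x i) L
  | γ, (i, false) :: L => (γ * (x i)⁻¹, i, false) :: tw x (γ * (x i)⁻¹) L

theorem tw_map_snd (x : I → Γ) (γ : Γ) (L : List (I × Bool)) :
    (tw x γ L).map Prod.snd = L := by
  induction L generalizing γ with
  | nil => rfl
  | cons a L ih =>
    obtain ⟨i, e⟩ := a
    cases e <;> simp [tw, ih]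

theorem tw_prod (x h : I → Γ) (γ : Γ) (L : List (I × Bool)) :
    γ * (L.map fun a => cond a.2 (h a.1 * x a.1) (h a.1 * x a.1)⁻¹).prod =
    ((tw x γ L).map fun a => a.1 * (cond a.2.2 (h a.2.1) (h a.2.1)⁻¹) * a.1⁻¹).prod *
      (γ * (L.map fun a => cond a.2 (x a.1) (x a.1)⁻¹).prod) := by
  induction L generalizing γ with
  | nil => simp [tw]
  | cons a L ih =>
    obtain ⟨i, e⟩ := a
    cases e
    · have := ih (γ * (x i)⁻¹)
      simp only [tw, List.map_cons, List.prod_cons, cond_false]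
      rw [mul_assoc (γ * (x i)⁻¹ * (h i)⁻¹ * (γ * (x i)⁻¹)⁻¹), ← mul_assoc γ (x i)⁻¹, ← this]
      group
    · have := ih (γ * x i)
      simp only [tw, List.map_cons, List.prod_cons, cond_true]
      rw [mul_assoc (γ * h i * γ⁻¹), ← mul_assoc γ (x i), ← this]
      group

end Twisted

section Assemble

theorem virt_solv_of_coset_identity {Γ K ι : Type*} [Group Γ] [Field K] [IsAlgClosed K]
    [Fintype ι] [DecidableEq ι] (ρ : Γ →* Matrix ι ι K) (hρ : Function.Injective ρ)
    {I : Type*} [Finite I] [DecidableEq I] (w : FreeGroup I) (hw : w ≠ 1) (H0 : Subgroup Γ)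
    (hH0 : H0.FiniteIndex) (x : I → Γ)
    (hid : ∀ h : I → Γ, (∀ i, h i ∈ H0) → FreeGroup.lift (fun i => h i * x i) w = 1) :
    ∃ H : Subgroup Γ, H.FiniteIndex ∧ IsSolvable H := by
  classical
  let ρ' : Unit → Γ →* Matrix ι ι K := fun _ => ρ
  have := coeffAlg_noeth ρ'
  obtain ⟨D, hD, hconn⟩ := exists_connected (coeffAlg ρ') (coeffAlg_left ρ')
  let H : Subgroup Γ := (D ⊓ H0).normalCore
  have hHfi : H.FiniteIndex := inferInstance
  have hHn : H.Normal := inferInstance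
  have hHD : H ≤ D := (Subgroup.normalCore_le _).trans inf_le_left
  have hHH0 : H ≤ H0 := (Subgroup.normalCore_le _).trans inf_le_right
  refine ⟨H, hHfi, ?_⟩
  let A : Subalgebra K (H → K) := (coeffAlg ρ').map (precompAlg K (Subtype.val : H → Γ))
  let β : Γ →* MulAut H := MulAut.conjNormal
  have hA : ∀ f ∈ A, ∀ g ∈ A, f * g = 0 → f = 0 ∨ g = 0 := by
    rintro _ ⟨f, hf, rfl⟩ _ ⟨g, hg, rfl⟩ hfg
    have h1 : ∀ d ∈ H, f d * g d = 0 := fun d hd => congrFun hfg ⟨d, hd⟩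
    rcases hconn H hHD hHfi f hf g hg h1 with h | h
    · left
      funext d
      exact h d.1 d.2
    · right
      funext d
      exact h d.1 d.2
  have hinv : ∀ f ∈ A, (fun h => f h⁻¹) ∈ A := by
    rintro _ ⟨f, hf, rfl⟩
    exact ⟨_, coeffAlg_inv ρ' f hf, rfl⟩
  have hβ : ∀ t, ∀ f ∈ A, (fun h => f (β t h)) ∈ A := by
    rintro t _ ⟨f, hf, rfl⟩
    refine ⟨_, coeffAlg_left ρ' t _ (coeffAlg_right ρ' t⁻¹ f hf), ?_⟩
    rfl
  let W := tw x 1 w.toWord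
  have hWs : W.map Prod.snd = w.toWord := tw_map_snd _ _ _
  have hW : W ≠ [] := by
    intro h
    rw [h] at hWs
    exact hw (FreeGroup.toWord_eq_nil_iff.1 hWs.symm)
  have hch : W.IsChain fun a b => a.2.1 = b.2.1 → a.2.2 = b.2.2 := by
    have h1 : (W.map Prod.snd).IsChain fun a b => a.1 = b.1 → a.2 = b.2 := by
      rw [hWs]
      exact FreeGroup.isReduced_toWord
    rwa [List.isChain_map] at h1
  have hlift : ∀ y : I → Γ, FreeGroup.lift y w =
      (w.toWord.map fun a => cond a.2 (y a.1) (y a.1)⁻¹).prod := by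
    intro y
    conv_lhs => rw [← FreeGroup.mk_toWord (x := w)]
    rw [FreeGroup.lift_mk]
  have hidW : ∀ y : I → H,
      (W.map fun a => β a.1 (cond a.2.2 (y a.2.1) (y a.2.1)⁻¹)).prod = 1 := by
    intro y
    have h1 := tw_prod x (fun i => (y i : Γ)) 1 w.toWord
    have h2 := hid (fun i => (y i : Γ)) (fun i => hHH0 (y i).2)
    have h3 := hid (fun i => 1) (fun i => H0.one_mem)
    simp only [one_mul] at h3
    rw [hlift] at h2 h3
    rw [one_mul, one_mul, h2, h3, mul_one] at h1
    apply Subtype.ext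
    rw [Subgroup.coe_one, h1, Subgroup.val_list_prod, List.map_map]
    refine congrArg List.prod (List.map_congr_left fun a _ => ?_)
    obtain ⟨t, i, e⟩ := a
    cases e <;> rfl
  let σ : H →* Module.End K (ι → K) :=
    ((Matrix.toLinAlgEquiv' : Matrix ι ι K ≃ₐ[K] _) : Matrix ι ι K →* Module.End K (ι → K)).comp
      (ρ.comp H.subtype)
  have hmem : ∀ p q, precompAlg K (Subtype.val : H → Γ) (fun g => ρ g p q) ∈ A :=
    fun p q => ⟨_, coeffAlg_mem ρ' () p q, rfl⟩
  obtain ⟨m, hm⟩ := solv_ind β A hA hinv hβ W hW hch hidW _ (ι → K) rfl σ (by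
    intro v f
    have : (fun h => f (σ h v)) = ∑ p, ∑ q, (f (Pi.single p 1) * v q) •
        precompAlg K (Subtype.val : H → Γ) (fun g => ρ g p q) := by
      funext h
      have h1 : σ h v = ∑ p, (∑ q, ρ h p q * v q) • (Pi.single p 1 : ι → K) := by
        funext j
        simp [Finset.sum_apply, Pi.single_apply, σ, Matrix.mulVec, dotProduct]
      rw [h1, map_sum]
      simp only [map_smul, Finset.sum_apply, Pi.smul_apply, smul_eq_mul, Finset.sum_mul]
      refine Finset.sum_congr rfl fun p _ => Finset.sum_congr rfl fun q _ => ?_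
      change ρ h p q * v q * f (Pi.single p 1) = f (Pi.single p 1) * v q * ρ h p q
      ring
    rw [this]
    exact Subalgebra.sum_mem _ fun p _ => Subalgebra.sum_mem _ fun q _ =>
      Subalgebra.smul_mem _ (hmem p q) _)
  refine ⟨⟨m, ?_⟩⟩
  rw [eq_bot_iff]
  intro h hh
  have h1 := hm h hh
  rw [Subgroup.mem_bot]
  apply Subtype.ext
  apply hρ
  rw [Subgroup.coe_one, map_one]
  have h2 : Matrix.toLinAlgEquiv' (ρ h) = (1 : Module.End K (ι → K)) := h1
  exact Matrix.toLinAlgEquiv'.injective (h2.trans (map_one _).symm)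

end Assemble

end Piece7

section Piece8

set_option linter.style.haveILetI false

section Bonf

theorem bonf {α β : Type*} [DecidableEq α] [DecidableEq β] (Z : β → Finset α) (e : ℝ) (he : 0 ≤ e)
    (S : Finset β) (h : ∀ i ∈ S, ∀ j ∈ S, i ≠ j → ((Z i ∩ Z j).card : ℝ) ≤ e) :
    ∑ i ∈ S, ((Z i).card : ℝ) ≤ ((S.biUnion Z).card : ℝ) + (S.card : ℝ) ^ 2 * e := by
  induction S using Finset.induction_on with
  | empty => simp
  | insert a S ha ih =>
    have ih' := ih (fun i hi j hj => h i (Finset.mem_insert_of_mem hi) j (Finset.mem_insert_of_mem hj))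
    rw [Finset.sum_insert ha, Finset.biUnion_insert, Finset.card_insert_of_notMem ha]
    have h1 : ((Z a ∪ S.biUnion Z).card : ℝ) + ((Z a ∩ S.biUnion Z).card : ℝ) =
        ((Z a).card : ℝ) + ((S.biUnion Z).card : ℝ) := by
      exact_mod_cast Finset.card_union_add_card_inter _ _
    have h2 : ((Z a ∩ S.biUnion Z).card : ℝ) ≤ S.card * e := by
      have h3 : Z a ∩ S.biUnion Z = S.biUnion fun j => Z a ∩ Z j := by
        ext q; simp only [Finset.mem_inter, Finset.mem_biUnion]; tauto
      rw [h3]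
      have h4 : ((S.biUnion fun j => Z a ∩ Z j).card : ℝ) ≤ ∑ j ∈ S, ((Z a ∩ Z j).card : ℝ) := by
        exact_mod_cast Finset.card_biUnion_le
      refine h4.trans ?_
      have := Finset.sum_le_card_nsmul S (fun j => ((Z a ∩ Z j).card : ℝ)) e (fun j hj =>
        h a (Finset.mem_insert_self _ _) j (Finset.mem_insert_of_mem hj)
          (fun hh => ha (hh ▸ hj)))
      simpa using this
    push_cast
    have h5 : (0:ℝ) ≤ S.card * e := by positivity
    nlinarith

end Bonf

section PartOne

variable {R G X : Type*} [CommRing R] [Group G]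

/-- zero locus modulo an ideal -/
def zLoc {Q : Type*} [Group Q] (A : Subalgebra R (G → R)) (π : G →* Q) (m : Ideal R)
    (M : Ideal A) : Set Q :=
  {q | ∀ g, π g = q → ∀ f ∈ M, f.1 g ∈ m}

theorem zLoc_sup {Q : Type*} [Group Q] (A : Subalgebra R (G → R)) (π : G →* Q) (m : Ideal R)
    (M M' : Ideal A) : zLoc A π m (M ⊔ M') = zLoc A π m M ∩ zLoc A π m M' := by
  ext q
  constructor
  · intro h
    exact ⟨fun g hg f hf => h g hg f (Ideal.mem_sup_left hf),
      fun g hg f hf => h g hg f (Ideal.mem_sup_right hf)⟩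
  · rintro ⟨h1, h2⟩ g hg f hf
    obtain ⟨a, ha, b, hb, rfl⟩ := Submodule.mem_sup.1 hf
    exact m.add_mem (h1 g hg a ha) (h2 g hg b hb)

theorem zLoc_mono {Q : Type*} [Group Q] (A : Subalgebra R (G → R)) (π : G →* Q) (m : Ideal R)
    {M M' : Ideal A} (h : M ≤ M') : zLoc A π m M' ⊆ zLoc A π m M :=
  fun _ hq g hg f hf => hq g hg f (h hf)

theorem zLoc_smul {Q : Type*} [Group Q] (A : Subalgebra R (G → R))
    (hA : ∀ a : G, ∀ f ∈ A, (fun g => f (a * g)) ∈ A) (π : G →* Q) (m : Ideal R)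
    (M : Ideal A) (a : G) :
    (zLoc A π m (M.comap (transl A hA a))) = (fun q => π a * q) '' (zLoc A π m M) := by
  ext q
  constructor
  · intro h
    refine ⟨(π a)⁻¹ * q, ?_, by simp⟩
    intro g hg f hf
    have h1 := h (a * g) (by rw [map_mul, hg]; simp) (transl A hA a⁻¹ f) (by
      rw [Ideal.mem_comap]
      convert hf
      apply Subtype.ext
      funext g
      change f.1 (a⁻¹ * (a * g)) = f.1 g
      simp)
    change f.1 (a⁻¹ * (a * g)) ∈ m at h1
    simpa using h1
  · rintro ⟨q, hq, rfl⟩ g hg f hf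
    have h1 := hq (a⁻¹ * g) (by simp only at hg; rw [map_mul, hg]; simp) _ hf
    change f.1 (a * (a⁻¹ * g)) ∈ m at h1
    simpa using h1

theorem coset_vanish (A : Subalgebra R (G → R))
    (hA : ∀ a : G, ∀ f ∈ A, (fun g => f (a * g)) ∈ A) [IsNoetherianRing A]
    (U : Ultrafilter X) (m : X → Ideal R) (hm : ∀ r : R, r ≠ 0 → ∀ᶠ x in U, r ∉ m x)
    (Q : X → Type*) [∀ x, Group (Q x)] [∀ x, Finite (Q x)] (π : ∀ x, G →* Q x)
    (hπ : ∀ x, Function.Surjective (π x))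
    (M0 : Ideal A) (ε : ℝ) (hε : 0 < ε)
    (hM0 : ∀ x, ε * Nat.card (Q x) ≤ (zLoc A (π x) (m x) M0).ncard) :
    ∃ (D : Subgroup G) (x0 : G), D.FiniteIndex ∧ ∀ d ∈ D, ∀ f ∈ M0, f.1 (d * x0) = 0 := by
  classical
  letI := translAction A hA
  have hcard : ∀ x, (0 : ℝ) < Nat.card (Q x) := fun x => by exact_mod_cast Nat.card_pos
  let Large : Ideal A → Prop := fun M => ∃ δ : ℝ, 0 < δ ∧
    ∀ᶠ x in U, δ * Nat.card (Q x) ≤ (zLoc A (π x) (m x) M).ncard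
  have hLs : ∀ (a : G) M x, (zLoc A (π x) (m x) (a • M)).ncard = (zLoc A (π x) (m x) M).ncard := by
    intro a M x
    have : zLoc A (π x) (m x) (a • M) = (fun q => π x a * q) '' (zLoc A (π x) (m x) M) :=
      zLoc_smul A hA (π x) (m x) M a
    rw [this, Set.ncard_image_of_injective _ (mul_right_injective _)]
  have hLsm : ∀ (a : G) M, Large M → Large (a • M) := by
    rintro a M ⟨δ, hδ, h⟩
    refine ⟨δ, hδ, ?_⟩
    simpa only [hLs] using h
  have hmono : ∀ d : G, ∀ Q Q' : Ideal A, Q ≤ Q' → d • Q ≤ d • Q' := by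
    intro d Q Q' h
    exact Ideal.comap_mono h
  obtain ⟨M, ⟨hM0M, hML⟩, hmax⟩ := WellFounded.has_min
    (wellFounded_gt (α := Ideal A)) {M | M0 ≤ M ∧ Large M} ⟨M0, le_rfl, ε, hε, .of_forall hM0⟩
  have hmax1 : ∀ L, Large L → M ≤ L → L = M := by
    intro L hL hle
    by_contra hne
    exact hmax L ⟨hM0M.trans hle, hL⟩ (lt_of_le_of_ne hle (Ne.symm hne))
  have hmax2 : ∀ (a : G) L, Large L → a • M ≤ L → L = a • M := by
    intro a L hL hle
    have h1 := hmono a⁻¹ _ _ hle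
    rw [inv_smul_smul] at h1
    rw [← hmax1 _ (hLsm a⁻¹ L hL) h1, smul_inv_smul]
  have hpair : ∀ P ∈ MulAction.orbit G M, ∀ P' ∈ MulAction.orbit G M, P ≠ P' →
      ¬ Large (P ⊔ P') := by
    rintro _ ⟨a, rfl⟩ _ ⟨b, rfl⟩ hne hL
    exact hne ((hmax2 a _ hL le_sup_left).symm.trans (hmax2 b _ hL le_sup_right))
  obtain ⟨δ, hδ, hδM⟩ := hML
  have horbit : (MulAction.orbit G M).Finite := by
    by_contra hinf
    obtain ⟨N, hN⟩ := exists_nat_gt (2 / δ)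
    obtain ⟨S, hS, hScard⟩ := Set.Infinite.exists_subset_card_eq hinf N
    have hN0 : (0 : ℝ) < N := lt_trans (by positivity) hN
    have hev : ∀ᶠ x in U, ∀ P ∈ S, ∀ P' ∈ S, P ≠ P' →
        ((zLoc A (π x) (m x) (P ⊔ P')).ncard : ℝ) ≤ 1 / N ^ 2 * Nat.card (Q x) := by
      rw [Filter.eventually_all_finset]
      intro P hP
      rw [Filter.eventually_all_finset]
      intro P' hP'
      by_cases hne : P = P'
      · exact .of_forall fun x h => absurd hne h
      have h1 : ¬ ∀ᶠ x in U, 1 / (N : ℝ) ^ 2 * Nat.card (Q x) ≤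
          (zLoc A (π x) (m x) (P ⊔ P')).ncard :=
        fun hh => hpair P (hS hP) P' (hS hP') hne ⟨1 / N ^ 2, by positivity, hh⟩
      rw [← Ultrafilter.eventually_not] at h1
      filter_upwards [h1] with x hx _
      exact (not_le.1 hx).le
    obtain ⟨x, hx1, hx2⟩ := (hev.and hδM).exists
    letI := Fintype.ofFinite (Q x)
    let Z : Ideal A → Finset (Q x) := fun P => (zLoc A (π x) (m x) P).toFinset
    have hZ : ∀ P, ((Z P).card : ℝ) = (zLoc A (π x) (m x) P).ncard := by
      intro P
      rw [Set.ncard_eq_toFinset_card']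
    have hb := bonf Z (1 / N ^ 2 * Nat.card (Q x)) (by positivity) S (by
      intro P hP P' hP' hne
      have := hx1 P hP P' hP' hne
      rw [zLoc_sup, Set.ncard_eq_toFinset_card', Set.toFinset_inter] at this
      exact this)
    have h1 : ∑ P ∈ S, ((Z P).card : ℝ) ≥ N * (δ * Nat.card (Q x)) := by
      rw [← hScard]
      have := Finset.card_nsmul_le_sum S (fun P => ((Z P).card : ℝ)) (δ * Nat.card (Q x)) (by
        intro P hP
        rw [hZ]
        obtain ⟨a, rfl⟩ := hS hP
        simp only [hLs]
        exact hx2)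
      simpa using this
    have h2 : ((S.biUnion Z).card : ℝ) ≤ Nat.card (Q x) := by
      rw [Nat.card_eq_fintype_card]
      exact_mod_cast Finset.card_le_univ _
    rw [hScard] at hb
    have h3 : (N : ℝ) ^ 2 * (1 / N ^ 2 * Nat.card (Q x)) = Nat.card (Q x) := by
      field_simp
    rw [h3] at hb
    have h4 : N * δ * Nat.card (Q x) ≤ 2 * Nat.card (Q x) := by linarith
    have h5 := le_of_mul_le_mul_right h4 (hcard x)
    rw [div_lt_iff₀ hδ] at hN
    linarith
  let D := MulAction.stabilizer G M
  have hDfi : D.FiniteIndex := ⟨by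
    rw [MulAction.index_stabilizer]
    exact ((Set.ncard_pos horbit).2 ⟨M, MulAction.mem_orbit_self M⟩).ne'⟩
  have hDM : ∀ d ∈ D, ∀ f ∈ M, transl A hA d f ∈ M := by
    intro d hd f hf
    have h1 : d • M = M := hd
    rw [← h1] at hf
    exact hf
  have hpt : ∀ᶠ x in U, ∃ g, ∀ f ∈ M, f.1 g ∈ m x := by
    filter_upwards [hδM] with x hx
    have : (0 : ℝ) < (zLoc A (π x) (m x) M).ncard := lt_of_lt_of_le (by have := hcard x; positivity) hx
    have h2 : 0 < (zLoc A (π x) (m x) M).ncard := by exact_mod_cast this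
    obtain ⟨q, hq⟩ := (Set.ncard_pos (Set.toFinite _)).1 h2
    obtain ⟨g, hg⟩ := hπ x q
    exact ⟨g, hq g hg⟩
  have hch : ∃ g : X → G, ∀ᶠ x in U, ∀ f ∈ M, f.1 (g x) ∈ m x := by
    refine ⟨fun x => if h : ∃ g, ∀ f ∈ M, f.1 g ∈ m x then h.choose else 1, ?_⟩
    filter_upwards [hpt] with x hx
    rw [dif_pos hx]
    exact hx.choose_spec
  obtain ⟨g, hg⟩ := hch
  have hfinq : Finite (G ⧸ D) := inferInstance
  obtain ⟨c, hc⟩ := Ultrafilter.eq_pure_of_finite (U.map fun x => (((g x)⁻¹ : G) : G ⧸ D))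
  obtain ⟨x0, rfl⟩ := QuotientGroup.mk_surjective c
  have hc' : ∀ᶠ x in U, (((g x)⁻¹ : G) : G ⧸ D) = (x0 : G ⧸ D) := by
    have : {q | q = (x0 : G ⧸ D)} ∈ (U.map fun x => (((g x)⁻¹ : G) : G ⧸ D)) := by
      rw [hc]; exact Ultrafilter.mem_pure.2 rfl
    exact this
  refine ⟨D, x0⁻¹, hDfi, ?_⟩
  have hzero : ∀ f ∈ M, f.1 x0⁻¹ = 0 := by
    intro f hf
    by_contra hne
    obtain ⟨x, ⟨h1, h2⟩, h3⟩ := ((hg.and hc').and (hm _ hne)).exists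
    rw [QuotientGroup.eq, inv_inv] at h2
    have h4 := h1 _ (hDM _ (D.inv_mem h2) f hf)
    change f.1 ((g x * x0)⁻¹ * g x) ∈ m x at h4
    apply h3
    simpa using h4
  intro d hd f hf
  exact hzero _ (hDM d hd f (hM0M hf))

end PartOne

end Piece8

section Piece9

section FiniteRes

theorem int_isJacobsonRing : IsJacobsonRing ℤ := by
  rw [isJacobsonRing_iff_prime_eq]
  intro P hP
  by_cases h0 : P = ⊥
  · subst h0
    rw [eq_bot_iff]
    intro x hx
    by_contra hx0
    have hx0 : x ≠ 0 := hx0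
    obtain ⟨p, hp, hpp⟩ := Nat.exists_infinite_primes (x.natAbs + 1)
    have hpI : Prime (p : ℤ) := Nat.prime_iff_prime_int.1 hpp
    have hmax : (Ideal.span {(p : ℤ)}).IsMaximal :=
      PrincipalIdealRing.isMaximal_of_irreducible hpI.irreducible
    rw [Ideal.jacobson, Ideal.mem_sInf] at hx
    have := hx ⟨bot_le, hmax⟩
    rw [Ideal.mem_span_singleton] at this
    have h2 := Int.natAbs_dvd_natAbs.2 this
    have h3 := Nat.le_of_dvd (Int.natAbs_pos.2 hx0) h2
    simp at h3
    omega
  · have : P.IsMaximal := hP.isMaximal h0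
    exact Ideal.jacobson_eq_self_of_isMaximal

theorem finite_residue {R : Type*} [CommRing R] [Algebra.FiniteType ℤ R] (m : Ideal R)
    [hm : m.IsMaximal] : Finite (R ⧸ m) := by
  let _ : Field (R ⧸ m) := Ideal.Quotient.field m
  have := int_isJacobsonRing
  have hft : Algebra.FiniteType ℤ (R ⧸ m) := inferInstance
  have hfin : Module.Finite ℤ (R ⧸ m) := finite_of_finite_type_of_isJacobsonRing ℤ (R ⧸ m)
  have hintg : Algebra.IsIntegral ℤ (R ⧸ m) := inferInstance
  have hninj : ¬ Function.Injective (algebraMap ℤ (R ⧸ m)) := by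
    intro hinj
    exact Int.not_isField (isField_of_isIntegral_of_isField hinj (Field.toIsField _))
  rw [injective_iff_map_eq_zero] at hninj
  push Not at hninj
  obtain ⟨n, hn, hn0⟩ := hninj
  apply Module.finite_of_fg_torsion
  intro x
  refine ⟨⟨n, mem_nonZeroDivisors_of_ne_zero hn0⟩, ?_⟩
  change n • x = 0
  rw [Algebra.smul_def, hn, zero_mul]

theorem exists_max_ultra {R : Type*} [CommRing R] [IsDomain R] [Algebra.FiniteType ℤ R] :
    ∃ U : Ultrafilter (MaximalSpectrum R), ∀ r : R, r ≠ 0 →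
      ∀ᶠ x : MaximalSpectrum R in (U : Filter (MaximalSpectrum R)), r ∉ x.asIdeal := by
  classical
  have := int_isJacobsonRing
  have hJ : IsJacobsonRing R := isJacobsonRing_of_finiteType (A := ℤ)
  have hex : ∀ r : R, r ≠ 0 → ∃ m : MaximalSpectrum R, r ∉ m.asIdeal := by
    intro r hr
    by_contra! h
    apply hr
    have h1 : r ∈ (⊥ : Ideal R).jacobson := by
      rw [Ideal.jacobson, Ideal.mem_sInf]
      rintro m ⟨-, hm⟩
      exact h ⟨m, hm⟩
    rw [← Ideal.radical_eq_jacobson] at h1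
    have h2 : (⊥ : Ideal R).radical = ⊥ := Ideal.IsPrime.radical Ideal.isPrime_bot
    rw [h2] at h1
    exact h1
  obtain ⟨U, hU⟩ := Ultrafilter.exists_ultrafilter_of_finite_inter_nonempty
    {s : Set (MaximalSpectrum R) | ∃ r : R, r ≠ 0 ∧ s = {x | r ∉ x.asIdeal}} (by
      intro T hT
      have : ∀ s : T, ∃ r : R, r ≠ 0 ∧ s.1 = {x | r ∉ x.asIdeal} := fun s => hT s.2
      choose r hr0 hr using this
      obtain ⟨m, hm⟩ := hex (∏ s : T, r s) (Finset.prod_ne_zero_iff.2 fun s _ => hr0 s)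
      refine ⟨m, ?_⟩
      intro s hs
      have := hr ⟨s, hs⟩
      simp only at this
      rw [this]
      intro hmem
      exact hm (Ideal.mem_of_dvd _ (Finset.dvd_prod_of_mem r (Finset.mem_univ _)) hmem))
  exact ⟨U, fun r hr => hU ⟨r, hr, rfl⟩⟩

end FiniteRes

end Piece9

section Piece10

section ProbCoset

theorem word_coeff_mem {Γ R ι I : Type*} [Group Γ] [CommRing R] [Fintype ι] [DecidableEq ι]
    (ρ : Γ →* Matrix ι ι R) (w : FreeGroup I) : ∀ p q,
    (fun g : I → Γ => ρ (FreeGroup.lift g w) p q) ∈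
      coeffAlg (fun s : I => ρ.comp (Pi.evalMonoidHom (fun _ : I => Γ) s)) := by
  induction w using FreeGroup.induction_on with
  | C1 =>
    intro p q
    have : (fun g : I → Γ => ρ (FreeGroup.lift g 1) p q) =
      algebraMap R ((I → Γ) → R) ((1 : Matrix ι ι R) p q) := by
      funext g
      simp [Pi.algebraMap_apply]
    rw [this]
    exact Subalgebra.algebraMap_mem _ _
  | of s =>
    intro p q
    have := coeffAlg_mem (fun s : I => ρ.comp (Pi.evalMonoidHom (fun _ : I => Γ) s)) s p q
    simpa using this
  | inv_of s _ =>
    intro p q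
    have := coeffAlg_mem_inv (fun s : I => ρ.comp (Pi.evalMonoidHom (fun _ : I => Γ) s)) s p q
    simpa using this
  | mul x y hx hy =>
    intro p q
    have : (fun g : I → Γ => ρ (FreeGroup.lift g (x * y)) p q) =
      ∑ j, (fun g : I → Γ => ρ (FreeGroup.lift g x) p j) *
        (fun g : I → Γ => ρ (FreeGroup.lift g y) j q) := by
      funext g
      simp [Matrix.mul_apply]
    rw [this]
    exact Subalgebra.sum_mem _ fun j _ => Subalgebra.mul_mem _ (hx p j) (hy j q)

theorem prob_to_coset {Γ R : Type*} [Group Γ] [CommRing R] [IsDomain R] [Algebra.FiniteType ℤ R]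
    {k n : ℕ} (ρ : Γ →* Matrix (Fin k) (Fin k) R) (hρ : Function.Injective ρ)
    (w : FreeGroup (Fin n)) (ε : ℝ) (hε : 0 < ε)
    (hN : ∀ (N : Subgroup Γ) (_ : N.Normal), N.FiniteIndex →
      ε * (Nat.card (Γ ⧸ N) : ℝ) ^ n ≤
        (Nat.card {h : Fin n → Γ ⧸ N // FreeGroup.lift h w = 1} : ℝ)) :
    ∃ H0 : Subgroup Γ, H0.FiniteIndex ∧ ∃ x : Fin n → Γ,
      ∀ h : Fin n → Γ, (∀ i, h i ∈ H0) → FreeGroup.lift (fun i => h i * x i) w = 1 := by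
  classical
  have hnR : IsNoetherianRing R := Algebra.FiniteType.isNoetherianRing ℤ R
  obtain ⟨U, hU⟩ := exists_max_ultra (R := R)
  let σ : Fin n → (Fin n → Γ) →* Matrix (Fin k) (Fin k) R :=
    fun s => ρ.comp (Pi.evalMonoidHom (fun _ : Fin n => Γ) s)
  have hnA : IsNoetherianRing (coeffAlg σ) := coeffAlg_noeth σ
  let red : ∀ m : MaximalSpectrum R, Γ →* (Matrix (Fin k) (Fin k) (R ⧸ m.asIdeal))ˣ := fun m =>
    (((Ideal.Quotient.mk m.asIdeal).mapMatrix.toMonoidHom).comp ρ).toHomUnits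
  let N : MaximalSpectrum R → Subgroup Γ := fun m => (red m).ker
  have hNn : ∀ m, (N m).Normal := fun m => MonoidHom.normal_ker _
  have hNmem : ∀ m g, g ∈ N m → ∀ p q, (ρ g - 1) p q ∈ m.asIdeal := by
    intro m g hg p q
    have h1 : red m g = 1 := hg
    have h2 := congrArg (fun u : (Matrix (Fin k) (Fin k) (R ⧸ m.asIdeal))ˣ => u.1 p q) h1
    have h3 : Ideal.Quotient.mk m.asIdeal (ρ g p q) =
      Ideal.Quotient.mk m.asIdeal ((1 : Matrix (Fin k) (Fin k) R) p q) := by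
      refine h2.trans ?_
      simp only [Units.val_one, Matrix.one_apply]
      split_ifs <;> simp
    rw [Matrix.sub_apply]
    exact Ideal.Quotient.eq.1 h3
  have hNf : ∀ m, (N m).FiniteIndex := by
    intro m
    have h1 : m.asIdeal.IsMaximal := m.isMaximal
    have h2 : Finite (R ⧸ m.asIdeal) := finite_residue m.asIdeal
    have h3 : Finite (Matrix (Fin k) (Fin k) (R ⧸ m.asIdeal)) :=
      inferInstanceAs (Finite (Fin k → Fin k → R ⧸ m.asIdeal))
    have h4 : Finite (Matrix (Fin k) (Fin k) (R ⧸ m.asIdeal))ˣ :=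
      Finite.of_injective _ Units.val_injective
    exact Subgroup.finiteIndex_ker (red m)
  let π : ∀ m, (Fin n → Γ) →* (Fin n → Γ ⧸ N m) := fun m =>
    (QuotientGroup.mk' (N m)).compLeft (Fin n)
  let c : Fin k × Fin k → coeffAlg σ := fun pq =>
    ⟨(fun g => ρ (FreeGroup.lift g w) pq.1 pq.2), word_coeff_mem ρ w pq.1 pq.2⟩ -
      algebraMap R _ ((1 : Matrix (Fin k) (Fin k) R) pq.1 pq.2)
  have hc : ∀ pq g, (c pq).1 g = (ρ (FreeGroup.lift g w) - 1) pq.1 pq.2 := fun pq g => rfl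
  let M0 : Ideal (coeffAlg σ) := Ideal.span (Set.range c)
  have hfinQ : ∀ m, Finite (Γ ⧸ N m) := fun m => inferInstance
  obtain ⟨D, x0, hD, hvan⟩ := coset_vanish (coeffAlg σ) (coeffAlg_left σ) U
    (fun m => m.asIdeal) hU (fun m => Fin n → Γ ⧸ N m) π (by
      intro m q
      choose g hg using fun i => QuotientGroup.mk'_surjective (N m) (q i)
      exact ⟨g, funext hg⟩) M0 ε hε (by
      intro m
      have h1 := hN (N m) (hNn m) (hNf m)
      have h2 : (Nat.card (Fin n → Γ ⧸ N m) : ℝ) = (Nat.card (Γ ⧸ N m) : ℝ) ^ n := by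
        rw [Nat.card_fun]; simp
      rw [h2]
      refine h1.trans ?_
      have h3 : Nat.card {h : Fin n → Γ ⧸ N m // FreeGroup.lift h w = 1} =
        {h : Fin n → Γ ⧸ N m | FreeGroup.lift h w = 1}.ncard := rfl
      rw [h3]
      norm_cast
      apply Set.ncard_le_ncard _ (Set.toFinite _)
      intro h hh g hg f hf
      have hmem : FreeGroup.lift g w ∈ N m := by
        rw [← QuotientGroup.eq_one_iff]
        have h5 : (QuotientGroup.mk' (N m)).comp (FreeGroup.lift g) = FreeGroup.lift h := by
          apply FreeGroup.ext_hom
          intro i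
          rw [← hg]
          simp [π]
        have h6 := DFunLike.congr_fun h5 w
        exact h6.trans hh
      induction hf using Submodule.span_induction with
      | mem f hf =>
        obtain ⟨pq, rfl⟩ := hf
        rw [hc]
        exact hNmem m _ hmem _ _
      | zero => exact Ideal.zero_mem _
      | add x y _ _ hx hy => exact Ideal.add_mem _ hx hy
      | smul a x _ hx => exact Ideal.mul_mem_left _ _ hx)
  have hD' : ∀ d ∈ D, FreeGroup.lift (d * x0) w = 1 := by
    intro d hd
    apply hρ
    rw [map_one]
    ext p q
    have h1 := hvan d hd (c (p, q)) (Ideal.subset_span ⟨_, rfl⟩)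
    rw [hc] at h1
    rw [Matrix.sub_apply] at h1
    exact sub_eq_zero.1 h1
  refine ⟨⨅ i, D.comap (MonoidHom.mulSingle (fun _ : Fin n => Γ) i), ?_, x0, ?_⟩
  · apply Subgroup.finiteIndex_iInf
    intro i
    refine ⟨?_⟩
    rw [Subgroup.index_comap]
    exact (inferInstance : (D.subgroupOf
      (MonoidHom.mulSingle (fun _ : Fin n => Γ) i).range).FiniteIndex).index_ne_zero
  · intro h hh
    apply hD' h
    apply Subgroup.pi_mem_of_mulSingle_mem
    intro i
    exact (Subgroup.mem_iInf.1 (hh i)) i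

end ProbCoset

end Piece10

section Piece11

section SolvWord

open scoped commutatorElement

theorem lift_map_word {I J G : Type*} [Group G] (e : I → J) (h : J → G) (w : FreeGroup I) :
    FreeGroup.lift h (FreeGroup.map e w) = FreeGroup.lift (fun i => h (e i)) w := by
  have : (FreeGroup.lift h).comp (FreeGroup.map e) = FreeGroup.lift (fun i => h (e i)) := by
    apply FreeGroup.ext_hom
    intro i
    simp
  exact DFunLike.congr_fun this w

theorem map_lift_word {I G G' : Type*} [Group G] [Group G'] (f : G →* G') (h : I → G)
    (w : FreeGroup I) :
    f (FreeGroup.lift h w) = FreeGroup.lift (fun i => f (h i)) w := by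
  have : f.comp (FreeGroup.lift h) = FreeGroup.lift (fun i => f (h i)) := by
    apply FreeGroup.ext_hom
    intro i
    simp
  exact DFunLike.congr_fun this w

theorem perm5_rel : ∃ x y z : Equiv.Perm (Fin 5), x ≠ 1 ∧ x = z * ⁅x, y * x * y⁻¹⁆ * z⁻¹ := by
  refine ⟨⟨![1, 2, 0, 3, 4], ![2, 0, 1, 3, 4], by decide, by decide⟩,
    ⟨![3, 4, 2, 0, 1], ![3, 4, 2, 0, 1], by decide, by decide⟩,
    ⟨![0, 3, 2, 1, 4], ![0, 3, 2, 1, 4], by decide, by decide⟩, by decide, by unfold_projs; decide⟩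

theorem solv_word_aux (x y z : Equiv.Perm (Fin 5)) (hx : x = z * ⁅x, y * x * y⁻¹⁆ * z⁻¹) (d : ℕ) :
    ∃ (I : Type) (_ : Fintype I) (w : FreeGroup I),
      (∀ s : Equiv.Perm (Fin 5), ∃ h : I → Equiv.Perm (Fin 5),
        FreeGroup.lift h w = s * x * s⁻¹) ∧
      ∀ (G : Type u) [Group G] (h : I → G), FreeGroup.lift h w ∈ derivedSeries G d := by
  induction d with
  | zero =>
    refine ⟨Unit, inferInstance, FreeGroup.of (), ?_, ?_⟩
    · intro s
      exact ⟨fun _ => s * x * s⁻¹, by simp⟩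
    · intro G _ h
      simp
  | succ d ih =>
    obtain ⟨I, hI, w, hw1, hw2⟩ := ih
    refine ⟨I ⊕ I, inferInstance, ⁅(FreeGroup.map Sum.inl w : FreeGroup (I ⊕ I)),
      (FreeGroup.map Sum.inr w : FreeGroup (I ⊕ I))⁆, ?_, ?_⟩
    · intro s
      obtain ⟨h1, e1⟩ := hw1 (s * z)
      obtain ⟨h2, e2⟩ := hw1 (s * z * y)
      refine ⟨Sum.elim h1 h2, ?_⟩
      rw [map_commutatorElement, lift_map_word, lift_map_word]
      simp only [Sum.elim_inl, Sum.elim_inr]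
      rw [e1, e2]
      conv_rhs => rw [hx]
      simp only [commutatorElement_def]
      group
    · intro G _ h
      rw [map_commutatorElement, lift_map_word, lift_map_word, derivedSeries_succ]
      exact Subgroup.commutator_mem_commutator (hw2 G _) (hw2 G _)

theorem solv_word (d : ℕ) :
    ∃ (n : ℕ) (w : FreeGroup (Fin n)), w ≠ 1 ∧
      ∀ (G : Type u) [Group G] (h : Fin n → G), FreeGroup.lift h w ∈ derivedSeries G d := by
  obtain ⟨x, y, z, hx1, hx⟩ := perm5_rel
  obtain ⟨I, hI, w, hw1, hw2⟩ := solv_word_aux.{u} x y z hx d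
  refine ⟨Fintype.card I, FreeGroup.map (Fintype.equivFin I) w, ?_, ?_⟩
  · intro h1
    obtain ⟨h, hh⟩ := hw1 1
    have h2 := lift_map_word (Fintype.equivFin I) (fun j => h ((Fintype.equivFin I).symm j)) w
    rw [h1] at h2
    simp only [map_one, Equiv.symm_apply_apply] at h2
    rw [← h2] at hh
    apply hx1
    simpa using hh.symm
  · intro G _ h
    rw [lift_map_word]
    exact hw2 G _

theorem virt_solv_prob (Γ : Type u) [Group Γ] (H : Subgroup Γ) (hH : H.FiniteIndex)
    (hs : IsSolvable H) :
    ∃ (n : ℕ) (w : FreeGroup (Fin n)), w ≠ 1 ∧ ∃ ε : ℝ, 0 < ε ∧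
      ∀ (N : Subgroup Γ) (_ : N.Normal), N.FiniteIndex →
      ε ≤ (Nat.card {h : Fin n → Γ ⧸ N // FreeGroup.lift h w = 1} : ℝ) /
        (Nat.card (Γ ⧸ N) : ℝ) ^ n := by
  obtain ⟨d, hd⟩ := hs.solvable
  obtain ⟨n, w, hw, hwd⟩ := solv_word.{u} d
  refine ⟨n, w, hw, (1 / (H.index : ℝ)) ^ n, ?_, ?_⟩
  · have : 0 < H.index := Nat.pos_of_ne_zero hH.index_ne_zero
    positivity
  · intro N hNn hNf
    have hfin : Finite (Γ ⧸ N) := inferInstance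
    let L : Subgroup (Γ ⧸ N) := H.map (QuotientGroup.mk' N)
    have hLd : L.index ∣ H.index := Subgroup.index_map_dvd H (QuotientGroup.mk'_surjective N)
    have hHpos : 0 < H.index := Nat.pos_of_ne_zero hH.index_ne_zero
    have hLle : L.index ≤ H.index := Nat.le_of_dvd hHpos hLd
    have hLc : Nat.card L * L.index = Nat.card (Γ ⧸ N) := Subgroup.card_mul_index L
    have hLpos : 0 < L.index := Nat.pos_of_ne_zero fun h => by
      rw [h] at hLd; exact hHpos.ne' (zero_dvd_iff.1 hLd)
    have hcpos : 0 < Nat.card L := Nat.card_pos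
    have key : ∀ h : Fin n → L, FreeGroup.lift (fun i => (h i : Γ ⧸ N)) w = 1 := by
      intro h
      choose k hk hk' using fun i => (h i).2
      have h1 : FreeGroup.lift (fun i => (⟨k i, hk i⟩ : H)) w = 1 := by
        have := hwd H (fun i => ⟨k i, hk i⟩)
        rw [hd] at this
        exact this
      have h2 := map_lift_word ((QuotientGroup.mk' N).comp H.subtype)
        (fun i => (⟨k i, hk i⟩ : H)) w
      rw [h1, map_one] at h2
      rw [h2]
      congr 2
      funext i
      exact (hk' i).symm
    have hle : Nat.card (Fin n → L) ≤
        Nat.card {h : Fin n → Γ ⧸ N // FreeGroup.lift h w = 1} := by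
      apply Nat.card_le_card_of_injective
        (fun h : Fin n → L => (⟨fun i => (h i : Γ ⧸ N), key h⟩ :
          {h : Fin n → Γ ⧸ N // FreeGroup.lift h w = 1}))
      intro a b hab
      funext i
      exact Subtype.ext (congrFun (congrArg Subtype.val hab) i)
    have hcf : Nat.card (Fin n → L) = Nat.card L ^ n := by
      rw [Nat.card_fun]; simp
    rw [hcf] at hle
    have hle' : (Nat.card L : ℝ) ^ n ≤
        (Nat.card {h : Fin n → Γ ⧸ N // FreeGroup.lift h w = 1} : ℝ) := by exact_mod_cast hle
    have hLc' : (Nat.card L : ℝ) * L.index = Nat.card (Γ ⧸ N) := by exact_mod_cast hLc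
    have hLle' : (L.index : ℝ) ≤ H.index := by exact_mod_cast hLle
    have hLpos' : (0 : ℝ) < L.index := by exact_mod_cast hLpos
    have hcpos' : (0 : ℝ) < Nat.card L := by exact_mod_cast hcpos
    calc (1 / (H.index : ℝ)) ^ n ≤ (1 / (L.index : ℝ)) ^ n := by gcongr
      _ = (Nat.card L : ℝ) ^ n / (Nat.card (Γ ⧸ N) : ℝ) ^ n := by
        rw [← hLc', ← div_pow]
        congr 1
        field_simp
      _ ≤ _ := by gcongr

end SolvWord

end Piece11

section Piece12

section HardDir

theorem exists_fg_ring {Γ F : Type*} [Group Γ] [Group.FG Γ] [Field F] {k : ℕ}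
    (ρ : Γ →* Matrix (Fin k) (Fin k) F) :
    ∃ R : Subalgebra ℤ F, Algebra.FiniteType ℤ R ∧ ∀ g p q, ρ g p q ∈ R := by
  obtain ⟨S, hS, hSf⟩ := Group.fg_iff.1 (inferInstance : Group.FG Γ)
  have hSf' : Finite S := hSf
  let c : Bool × S × Fin k × Fin k → F := fun x =>
    ρ (cond x.1 x.2.1.1 x.2.1.1⁻¹) x.2.2.1 x.2.2.2
  refine ⟨Algebra.adjoin ℤ (Set.range c), ?_, ?_⟩
  · rw [← Subalgebra.fg_iff_finiteType]
    exact ⟨(Set.finite_range c).toFinset, by rw [Set.Finite.coe_toFinset]⟩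
  · have key : ∀ g ∈ Subgroup.closure S,
        (∀ p q, ρ g p q ∈ Algebra.adjoin ℤ (Set.range c)) ∧
        (∀ p q, ρ g⁻¹ p q ∈ Algebra.adjoin ℤ (Set.range c)) := by
      intro g hg
      induction hg using Subgroup.closure_induction with
      | mem s hs =>
        exact ⟨fun p q => Algebra.subset_adjoin ⟨(true, ⟨s, hs⟩, p, q), rfl⟩,
          fun p q => Algebra.subset_adjoin ⟨(false, ⟨s, hs⟩, p, q), rfl⟩⟩
      | one =>
        have : ∀ p q, (1 : Matrix (Fin k) (Fin k) F) p q ∈ Algebra.adjoin ℤ (Set.range c) := by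
          intro p q
          rw [Matrix.one_apply]
          split_ifs
          · exact Subalgebra.one_mem _
          · exact Subalgebra.zero_mem _
        simpa using this
      | mul x y _ _ hx hy =>
        refine ⟨fun p q => ?_, fun p q => ?_⟩
        · rw [map_mul, Matrix.mul_apply]
          exact Subalgebra.sum_mem _ fun j _ => Subalgebra.mul_mem _ (hx.1 p j) (hy.1 j q)
        · rw [_root_.mul_inv_rev, map_mul, Matrix.mul_apply]
          exact Subalgebra.sum_mem _ fun j _ => Subalgebra.mul_mem _ (hy.2 p j) (hx.2 j q)
      | inv x _ hx => exact ⟨hx.2, by simpa using hx.1⟩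
    intro g
    exact (key g (by rw [hS]; trivial)).1

theorem prob_virt_solv {Γ F : Type*} [Group Γ] [Group.FG Γ] [Field F] {k n : ℕ}
    (ρ : Γ →* Matrix (Fin k) (Fin k) F) (hρ : Function.Injective ρ)
    (w : FreeGroup (Fin n)) (hw : w ≠ 1) (ε : ℝ) (hε : 0 < ε)
    (hN : ∀ (N : Subgroup Γ) (_ : N.Normal), N.FiniteIndex →
      ε ≤ (Nat.card {h : Fin n → Γ ⧸ N // FreeGroup.lift h w = 1} : ℝ) /
        (Nat.card (Γ ⧸ N) : ℝ) ^ n) :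
    ∃ H : Subgroup Γ, H.FiniteIndex ∧ IsSolvable H := by
  obtain ⟨R, hR, hmem⟩ := exists_fg_ring ρ
  let ρR : Γ →* Matrix (Fin k) (Fin k) R :=
    { toFun := fun g => Matrix.of fun p q => ⟨ρ g p q, hmem g p q⟩
      map_one' := by
        ext p q
        simp only [map_one, Matrix.of_apply, Matrix.one_apply]
        split_ifs <;> rfl
      map_mul' := by
        intro x y
        ext p q
        simp [Matrix.mul_apply] }
  have hρR : Function.Injective ρR := by
    intro a b hab
    apply hρ
    ext p q
    exact congrArg (fun A : Matrix (Fin k) (Fin k) R => (A p q : F)) hab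
  obtain ⟨H0, hH0, x, hx⟩ := prob_to_coset ρR hρR w ε hε (by
    intro N hNn hNf
    have hfin : Finite (Γ ⧸ N) := inferInstance
    have hpos : (0 : ℝ) < (Nat.card (Γ ⧸ N) : ℝ) ^ n := by
      have : 0 < Nat.card (Γ ⧸ N) := Nat.card_pos
      positivity
    exact (le_div_iff₀ hpos).1 (hN N hNn hNf))
  let ρK : Γ →* Matrix (Fin k) (Fin k) (AlgebraicClosure F) :=
    (algebraMap F (AlgebraicClosure F)).mapMatrix.toMonoidHom.comp ρ
  have hρK : Function.Injective ρK := by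
    intro a b hab
    apply hρ
    ext p q
    apply (algebraMap F (AlgebraicClosure F)).injective
    exact congrArg (fun A : Matrix (Fin k) (Fin k) (AlgebraicClosure F) => A p q) hab
  exact virt_solv_of_coset_identity ρK hρK w hw H0 hH0 x hx

end HardDir

end Piece12

/-- A finitely generated linear group satisfies a probabilistic identity if and only if
it is virtually solvable. -/
theorem probabilistic_identity_iff_virtually_solvable (Γ : Type u) [Group Γ] [Group.FG Γ]
    (hlin : IsLinearGroup.{u, v} Γ) :
    (∃ (n : ℕ) (w : FreeGroup (Fin n)), IsProbabilisticIdentity Γ w) ↔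
      IsVirtuallySolvable Γ := by
  constructor
  · rintro ⟨n, w, hw, ε, hε, hN⟩
    obtain ⟨F, hF, k, ρ, hρ⟩ := hlin
    exact prob_virt_solv ((Units.coeHom (Matrix (Fin k) (Fin k) F)).comp ρ)
      (Units.val_injective.comp hρ) w hw ε hε hN
  · rintro ⟨H, hH, hs⟩
    exact virt_solv_prob Γ H hH hs
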